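/- arXiv:1208.2170 — 2 statements merged into one kernel-verified Lean document; each statement's English description precedes it below -/
import Mathlib

section
/- As X → ∞, the product over primes p > X^{1/4} of (1 + p⁻¹)/(1 + p⁻¹ + p^{−4/3}) equals 1 − (12 + o(1))·X^{−1/12}/log X; that is, lim_{X→∞} X^{1/12}·(log X)·(1 − ∏_{p > X^{1/4}} (1 + p⁻¹)/(1 + p⁻¹ + p^{−4/3})) = 12. -/
open Filter
open scoped Classical

namespace TPM
open MeasureTheory Set Topology
open ArithmeticFunction (vonMangoldt)

noncomputable def aa (u : ℝ) : ℝ := Chebyshev.psi (Real.exp u) * Real.exp (-u)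

lemma aa_nonneg (u : ℝ) : 0 ≤ aa u :=
  mul_nonneg (Chebyshev.psi_nonneg _) (Real.exp_pos _).le

lemma aa_le (u : ℝ) : aa u ≤ Real.log 4 + 4 := by
  have h := Chebyshev.psi_le_const_mul_self (Real.exp_pos u).le
  calc aa u ≤ ((Real.log 4 + 4) * Real.exp u) * Real.exp (-u) :=
        mul_le_mul_of_nonneg_right h (Real.exp_pos _).le
    _ = Real.log 4 + 4 := by rw [mul_assoc, ← Real.exp_add]; simp

lemma aa_mono : Monotone fun u => aa u * Real.exp u := by
  have : (fun u => aa u * Real.exp u) = fun u => Chebyshev.psi (Real.exp u) := by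
    ext u; simp [aa, mul_assoc, ← Real.exp_add]
  rw [this]
  exact Chebyshev.psi_mono.comp Real.exp_monotone

lemma aa_meas : Measurable aa :=
  (Chebyshev.psi_mono.measurable.comp Real.measurable_exp).mul
    (Real.measurable_exp.comp measurable_neg)

lemma aa_neg (u : ℝ) (hu : u < 0) : aa u = 0 := by
  rw [aa, Chebyshev.psi_eq_zero_of_le_one, zero_mul]
  exact Real.exp_le_one_iff.mpr hu.le

noncomputable def HH : ℂ → ℂ :=
  ArithmeticFunction.vonMangoldt.LFunctionResidueClassAux (1 : ZMod 1)

noncomputable def GG (z : ℂ) : ℂ := (HH (1 + z) - 1) / (1 + z)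

lemma GG_cont : ContinuousOn GG {z | 0 ≤ z.re} := by
  have h : ContinuousOn HH {s | 1 ≤ s.re} :=
    ArithmeticFunction.vonMangoldt.continuousOn_LFunctionResidueClassAux (1 : ZMod 1)
  refine ContinuousOn.div (ContinuousOn.sub (h.comp (by fun_prop) ?_) continuousOn_const)
    (by fun_prop) ?_
  · intro z hz; simpa using hz
  · intro z hz h0
    have : (1 + z).re = 0 := by rw [h0]; simp
    simp at this hz
    linarith

lemma HH_eq {s : ℂ} (hs : 1 < s.re) :
    HH s = LSeries (fun n => (vonMangoldt n : ℂ)) s - 1 / (s - 1) := by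
  have := ArithmeticFunction.vonMangoldt.eqOn_LFunctionResidueClassAux (a := (1 : ZMod 1))
    isUnit_one hs
  rw [HH, this]
  have h2 : ArithmeticFunction.vonMangoldt.residueClass (1 : ZMod 1) = fun n => vonMangoldt n := by
    ext n
    rw [ArithmeticFunction.vonMangoldt.residueClass]
    exact Set.indicator_of_mem (by exact Subsingleton.elim _ _) _
  simp [h2]

lemma laplace_aa {z : ℂ} (hz : 0 < z.re) :
    ∫ u in Ioi (0:ℝ), (aa u : ℂ) * Complex.exp (-z * u) =
      LSeries (fun n => (vonMangoldt n : ℂ)) (1 + z) / (1 + z) := by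
  have hs : (1:ℝ) < (1 + z).re := by simpa using hz
  have h0 : (1 + z) ≠ 0 := by
    intro h; rw [h] at hs; simp at hs; linarith
  have := LSeries_eq_mul_integral_of_nonneg (fun n => vonMangoldt n) (r := 1) zero_le_one hs ?_
    (fun n => ArithmeticFunction.vonMangoldt_nonneg)
  · rw [this, mul_div_cancel_left₀ _ h0]
    have h1 := integral_comp_log_Ioi (fun u : ℝ => (aa u : ℂ) * Complex.exp (-z * u))
      (zero_lt_one)
    rw [Real.log_one] at h1
    rw [← h1]
    refine setIntegral_congr_fun measurableSet_Ioi fun t ht => ?_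
    have ht0 : (0:ℝ) < t := lt_trans zero_lt_one ht
    have htc : (t:ℂ) ≠ 0 := by exact_mod_cast ht0.ne'
    simp only [aa, Real.exp_log ht0, Real.exp_neg]
    have e1 : Complex.exp (-z * (Real.log t : ℝ)) = (t:ℂ) ^ (-z) := by
      rw [Complex.cpow_def_of_ne_zero htc, ← Complex.ofReal_log ht0.le, mul_comm]
    have e2 : (t:ℂ) ^ (-(1 + z + 1)) = (t:ℂ) ^ (-z) * (t:ℂ)⁻¹ * (t:ℂ)⁻¹ := by
      rw [show -(1 + z + 1) = -z - 1 - 1 by ring, Complex.cpow_sub _ _ htc, Complex.cpow_sub _ _ htc]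
      simp [div_eq_mul_inv]
    rw [e1, e2]
    have e3 : (∑ k ∈ Finset.Icc 1 ⌊t⌋₊, (vonMangoldt k : ℂ)) = (Chebyshev.psi t : ℂ) := by
      rw [Chebyshev.psi]; push_cast; rfl
    rw [e3]
    rw [Complex.real_smul]; push_cast; ring
  · refine Asymptotics.IsBigO.of_bound (Real.log 4 + 4) (Eventually.of_forall fun n => ?_)
    have e3 : (∑ k ∈ Finset.Icc 1 n, vonMangoldt k) = Chebyshev.psi n := by
      rw [Chebyshev.psi]; simp; rfl
    rw [e3, Real.rpow_one, Real.norm_of_nonneg (Chebyshev.psi_nonneg _),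
      Real.norm_of_nonneg n.cast_nonneg]
    exact Chebyshev.psi_le_const_mul_self n.cast_nonneg

lemma int_exp {z : ℂ} (hz : 0 < z.re) :
    IntegrableOn (fun u : ℝ => Complex.exp (-z * u)) (Ioi (0:ℝ)) :=
  integrableOn_exp_mul_complex_Ioi (by simpa using hz) 0

lemma laplace {z : ℂ} (hz : 0 < z.re) :
    ∫ u in Ioi (0:ℝ), ((aa u - 1 : ℝ) : ℂ) * Complex.exp (-z * u) = GG z := by
  have hs : (1:ℝ) < (1 + z).re := by simpa using hz
  have h0 : (1 + z) ≠ 0 := by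
    intro h; rw [h] at hs; simp at hs; linarith
  have hz0 : z ≠ 0 := by
    intro h; rw [h] at hz; simp at hz
  have hi : IntegrableOn (fun u : ℝ => (aa u : ℂ) * Complex.exp (-z * u)) (Ioi (0:ℝ)) := by
    refine Integrable.bdd_mul (c := Real.log 4 + 4) (int_exp hz)
      (Complex.measurable_ofReal.comp aa_meas).aestronglyMeasurable ?_
    refine Eventually.of_forall fun u => ?_
    rw [Complex.norm_real, Real.norm_of_nonneg (aa_nonneg u)]
    exact aa_le u
  have : ∀ u : ℝ, ((aa u - 1 : ℝ) : ℂ) * Complex.exp (-z * u) =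
    (aa u : ℂ) * Complex.exp (-z * u) - Complex.exp (-z * u) := by
    intro u; push_cast; ring
  simp_rw [this]
  rw [integral_sub hi (int_exp hz), laplace_aa hz, integral_exp_mul_complex_Ioi (by simpa using hz) 0,
    GG, HH_eq hs]
  have : 1 + z - 1 ≠ 0 := by simpa using hz0
  simp only [Complex.ofReal_zero, mul_zero, Complex.exp_zero]
  field_simp
  ring
/-! Fejer kernel -/

noncomputable def KK (x : ℝ) : ℝ := Real.sinc (x / 2) ^ 2

lemma KK_nonneg (x : ℝ) : 0 ≤ KK x := sq_nonneg _

lemma KK_cont : Continuous KK := by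
  unfold KK
  exact (Real.continuous_sinc.comp (by fun_prop)).pow 2

lemma KK_bound (x : ℝ) : KK x ≤ 5 * (1 + x ^ 2)⁻¹ := by
  rw [← div_eq_mul_inv, le_div_iff₀ (by positivity)]
  have h1 : KK x ≤ 1 := by
    unfold KK
    rw [sq_le_one_iff_abs_le_one]
    exact abs_le.mpr ⟨Real.neg_one_le_sinc _, Real.sinc_le_one _⟩
  have h2 : KK x * x ^ 2 ≤ 4 := by
    by_cases hx : x = 0
    · simp [hx]
    · unfold KK
      rw [Real.sinc_of_ne_zero (by simpa using hx)]
      have := Real.sin_sq_le_one (x / 2)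
      have e : (Real.sin (x / 2) / (x / 2)) ^ 2 * x ^ 2 = 4 * Real.sin (x/2) ^ 2 := by
        field_simp; try ring
      rw [e]; linarith
  nlinarith

lemma KK_int : Integrable KK :=
  (integrable_inv_one_add_sq.const_mul 5).mono' KK_cont.aestronglyMeasurable
    (Eventually.of_forall fun x => by
      rw [Real.norm_of_nonneg (KK_nonneg x)]; exact KK_bound x)

lemma KK_pos : 0 < ∫ x, KK x := by
  rw [integral_pos_iff_support_of_nonneg KK_nonneg KK_int]
  refine IsOpen.measure_pos volume KK_cont.isOpen_support ⟨0, ?_⟩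
  simp [KK]

lemma KK_fourier {x : ℝ} (hx : x ≠ 0) :
    ∫ t in Ioc (-1:ℝ) 1, ((1 - |t| : ℝ) : ℂ) * Complex.exp (Complex.I * x * t) = (KK x : ℂ) := by
  set c : ℂ := Complex.I * x with hc
  have hc0 : c ≠ 0 := by simp [hc, hx]
  rw [← intervalIntegral.integral_of_le (by norm_num)]
  have hcont : Continuous fun t : ℝ => ((1 - |t| : ℝ) : ℂ) * Complex.exp (c * t) := by fun_prop
  rw [← intervalIntegral.integral_add_adjacent_intervals (b := 0) (hcont.intervalIntegrable _ _)
    (hcont.intervalIntegrable _ _)]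
  have hexp : ∀ t : ℝ, HasDerivAt (fun t : ℝ => Complex.exp (c * t)) (Complex.exp (c * t) * c) t := by
    intro t
    have := ((hasDerivAt_id t).ofReal_comp.const_mul c).cexp
    simpa using this
  have hid : ∀ t : ℝ, HasDerivAt (fun t : ℝ => (t : ℂ)) 1 t := fun t => by
    simpa using (hasDerivAt_id t).ofReal_comp
  have h1 : ∫ t in (0:ℝ)..1, ((1 - |t| : ℝ) : ℂ) * Complex.exp (c * t) =
      Complex.exp c / c ^ 2 - (1 / c + 1 / c ^ 2) := by
    have e : ∫ t in (0:ℝ)..1, ((1 - |t| : ℝ) : ℂ) * Complex.exp (c * t) =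
        ∫ t in (0:ℝ)..1, (1 - (t:ℂ)) * Complex.exp (c * t) := by
      refine intervalIntegral.integral_congr fun t ht => ?_
      rw [uIcc_of_le zero_le_one] at ht
      simp [abs_of_nonneg ht.1]
    rw [e, intervalIntegral.integral_eq_sub_of_hasDerivAt
      (f := fun t : ℝ => (1 - (t:ℂ)) * (Complex.exp (c * t) / c) + Complex.exp (c * t) / c ^ 2)]
    · simp
    · intro t _
      convert! (((hid t).const_sub 1).mul ((hexp t).div_const c)).add ((hexp t).div_const (c ^ 2)) using 1
      field_simp; ring
    · exact Continuous.intervalIntegrable (by fun_prop) _ _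
  have h2 : ∫ t in (-1:ℝ)..0, ((1 - |t| : ℝ) : ℂ) * Complex.exp (c * t) =
      1 / c - 1 / c ^ 2 + Complex.exp (-c) / c ^ 2 := by
    have e : ∫ t in (-1:ℝ)..0, ((1 - |t| : ℝ) : ℂ) * Complex.exp (c * t) =
        ∫ t in (-1:ℝ)..0, (1 + (t:ℂ)) * Complex.exp (c * t) := by
      refine intervalIntegral.integral_congr fun t ht => ?_
      rw [uIcc_of_le (by norm_num)] at ht
      simp [abs_of_nonpos ht.2]
    rw [e, intervalIntegral.integral_eq_sub_of_hasDerivAt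
      (f := fun t : ℝ => (1 + (t:ℂ)) * (Complex.exp (c * t) / c) - Complex.exp (c * t) / c ^ 2)]
    · simp
    · intro t _
      convert! (((hid t).const_add 1).mul ((hexp t).div_const c)).sub ((hexp t).div_const (c ^ 2)) using 1
      field_simp; ring
    · exact Continuous.intervalIntegrable (by fun_prop) _ _
  rw [h1, h2]
  have h3 : Complex.exp c + Complex.exp (-c) = 2 * Real.cos x := by
    rw [Complex.ofReal_cos, Complex.cos, hc]; ring_nf
  have h4 : (c:ℂ) ^ 2 = -(x:ℂ) ^ 2 := by rw [hc, mul_pow, Complex.I_sq]; ring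
  have h5 : (1 / c - 1 / c ^ 2 + Complex.exp (-c) / c ^ 2 + (Complex.exp c / c ^ 2 - (1 / c + 1 / c ^ 2)))
    = ((Complex.exp c + Complex.exp (-c)) - 2) / c ^ 2 := by ring
  rw [h5, h3, h4, KK, Real.sinc_of_ne_zero (by simpa using hx)]
  have h6 : Real.cos x = 1 - 2 * Real.sin (x / 2) ^ 2 := by
    have := Real.cos_sq' (x/2)
    have h7 := Real.cos_two_mul (x/2)
    rw [show 2 * (x / 2) = x by ring] at h7
    linarith
  rw [h6]
  have hxc : (x:ℂ) ≠ 0 := by exact_mod_cast hx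
  push_cast
  field_simp
  ring

lemma smooth_eq {ε l : ℝ} (hε : 0 < ε) (hl : 0 < l) (v : ℝ) :
    ∫ u in Ioi (0:ℝ), ((aa u - 1 : ℝ) : ℂ) * Complex.exp (-ε * u) * (KK (l * (v - u)) : ℂ) =
    ∫ t in Ioc (-1:ℝ) 1, ((1 - |t| : ℝ) : ℂ) * Complex.exp (Complex.I * (l * v) * t) *
      GG (ε + Complex.I * l * t) := by
  have hae : ∀ᵐ u : ℝ ∂(volume.restrict (Ioi (0:ℝ))), u ≠ v := by
    apply ae_restrict_of_ae
    exact Measure.ae_ne volume v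
  have e1 : ∫ u in Ioi (0:ℝ), ((aa u - 1 : ℝ) : ℂ) * Complex.exp (-ε * u) * (KK (l * (v - u)) : ℂ) =
      ∫ u in Ioi (0:ℝ), ∫ t in Ioc (-1:ℝ) 1, ((aa u - 1 : ℝ) : ℂ) * Complex.exp (-ε * u) *
        (((1 - |t| : ℝ) : ℂ) * Complex.exp (Complex.I * (l * (v - u) : ℝ) * t)) := by
    refine integral_congr_ae ?_
    filter_upwards [hae] with u hu
    rw [integral_const_mul, KK_fourier]
    exact mul_ne_zero hl.ne' (sub_ne_zero.mpr hu.symm)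
  rw [e1, integral_integral_swap]
  · refine setIntegral_congr_fun measurableSet_Ioc fun t _ => ?_
    rw [← laplace (z := ε + Complex.I * l * t) (by simpa using hε), ← integral_const_mul]
    refine integral_congr_ae (Eventually.of_forall fun u => ?_)
    simp only
    have : Complex.exp (-ε * u) * Complex.exp (Complex.I * (l * (v - u) : ℝ) * t) =
      Complex.exp (Complex.I * (l * v) * t) * Complex.exp (-(ε + Complex.I * l * t) * u) := by
      rw [← Complex.exp_add, ← Complex.exp_add]; congr 1; push_cast; ring
    linear_combination (((aa u - 1 : ℝ) : ℂ) * ((1 - |t| : ℝ) : ℂ)) * this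
  · have i1 : Integrable (fun u : ℝ => ((aa u - 1 : ℝ) : ℂ) * Complex.exp (-ε * u))
        (volume.restrict (Ioi (0:ℝ))) := by
      refine Integrable.bdd_mul (c := Real.log 4 + 5) (int_exp (z := ε) (by simpa using hε))
        (Complex.measurable_ofReal.comp (aa_meas.sub_const 1)).aestronglyMeasurable ?_
      refine Eventually.of_forall fun u => ?_
      rw [Complex.norm_real, Real.norm_eq_abs, abs_le]
      have h4 := Real.log_nonneg (show (1:ℝ) ≤ 4 by norm_num)
      constructor <;> linarith [aa_nonneg u, aa_le u]
    have i2 : Integrable (fun t : ℝ => ((1 - |t| : ℝ) : ℂ)) (volume.restrict (Ioc (-1:ℝ) 1)) := by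
      have : Continuous fun t : ℝ => ((1 - |t| : ℝ) : ℂ) := by fun_prop
      exact this.integrableOn_Ioc
    have i3 := (i1.mul_prod i2).mul_bdd (c := 1)
      (g := fun p : ℝ × ℝ => Complex.exp (Complex.I * (l * (v - p.1) : ℝ) * p.2))
      (Continuous.aestronglyMeasurable (by fun_prop)) (Eventually.of_forall fun p => by
        rw [Complex.norm_exp]; simp)
    refine i3.congr (Eventually.of_forall fun p => ?_)
    simp [Function.uncurry, mul_assoc]

lemma smooth_eq0 {l : ℝ} (hl : 0 < l) (v : ℝ) :
    ∫ u in Ioi (0:ℝ), ((aa u - 1 : ℝ) : ℂ) * (KK (l * (v - u)) : ℂ) =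
    ∫ t in Ioc (-1:ℝ) 1, ((1 - |t| : ℝ) : ℂ) * Complex.exp (Complex.I * (l * v) * t) *
      GG (Complex.I * l * t) := by
  have hK : Integrable (fun u : ℝ => KK (l * (v - u))) := by
    have := (KK_int.comp_mul_left' hl.ne').comp_sub_left v
    exact this
  have lim1 : Tendsto (fun ε : ℝ => ∫ u in Ioi (0:ℝ), ((aa u - 1 : ℝ) : ℂ) *
      Complex.exp (-ε * u) * (KK (l * (v - u)) : ℂ)) (𝓝[>] 0)
      (𝓝 (∫ u in Ioi (0:ℝ), ((aa u - 1 : ℝ) : ℂ) * (KK (l * (v - u)) : ℂ))) := by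
    refine tendsto_integral_filter_of_dominated_convergence
      (fun u => (Real.log 4 + 5) * KK (l * (v - u))) ?_ ?_ ?_ ?_
    · refine Eventually.of_forall fun ε => Measurable.aestronglyMeasurable ?_
      have := aa_meas
      have := KK_cont.measurable
      fun_prop
    · filter_upwards [self_mem_nhdsWithin] with ε hε
      filter_upwards [ae_restrict_mem measurableSet_Ioi] with u hu
      rw [norm_mul, norm_mul, Complex.norm_real, Complex.norm_real, Complex.norm_exp,
        Real.norm_of_nonneg (KK_nonneg _)]
      refine mul_le_mul_of_nonneg_right ?_ (KK_nonneg _)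
      have h1 : |aa u - 1| ≤ Real.log 4 + 5 := by
        rw [abs_le]
        have h4 := Real.log_nonneg (show (1:ℝ) ≤ 4 by norm_num)
        constructor <;> linarith [aa_nonneg u, aa_le u]
      have h2 : Real.exp ((-(ε:ℂ) * u).re) ≤ 1 := by
        rw [Real.exp_le_one_iff]
        have : 0 ≤ ε * u := mul_nonneg (le_of_lt hε) (le_of_lt hu)
        simpa using this
      calc _ ≤ (Real.log 4 + 5) * 1 := mul_le_mul h1 h2 (Real.exp_pos _).le
            ((abs_nonneg _).trans h1)
        _ = _ := mul_one _
    · exact (hK.const_mul _).integrableOn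
    · refine Eventually.of_forall fun u => ?_
      have : Continuous fun ε : ℝ => ((aa u - 1 : ℝ) : ℂ) *
        Complex.exp (-ε * u) * (KK (l * (v - u)) : ℂ) := by fun_prop
      have h := this.tendsto 0
      simp only [Complex.ofReal_zero, neg_zero, zero_mul, Complex.exp_zero, mul_one] at h
      exact h.mono_left nhdsWithin_le_nhds
  have hbdd : ∃ M, ∀ p ∈ (Icc (0:ℝ) 1 ×ˢ Icc (-1:ℝ) 1), ‖GG (p.1 + Complex.I * l * p.2)‖ ≤ M := by
    refine IsCompact.exists_bound_of_continuousOn (isCompact_Icc.prod isCompact_Icc) ?_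
    refine GG_cont.comp (by fun_prop) ?_
    rintro ⟨a, b⟩ ⟨h, -⟩
    simpa using h.1
  obtain ⟨M, hM⟩ := hbdd
  have hmeasG : ∀ ε : ℝ, 0 ≤ ε → ContinuousOn (fun t : ℝ => GG (ε + Complex.I * l * t)) univ := by
    intro ε hε
    refine GG_cont.comp (by fun_prop) ?_
    intro t _
    simpa using hε
  have lim2 : Tendsto (fun ε : ℝ => ∫ t in Ioc (-1:ℝ) 1, ((1 - |t| : ℝ) : ℂ) *
      Complex.exp (Complex.I * (l * v) * t) * GG (ε + Complex.I * l * t)) (𝓝[>] 0)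
      (𝓝 (∫ t in Ioc (-1:ℝ) 1, ((1 - |t| : ℝ) : ℂ) * Complex.exp (Complex.I * (l * v) * t) *
      GG (Complex.I * l * t))) := by
    refine tendsto_integral_filter_of_dominated_convergence (fun _ => M) ?_ ?_ ?_ ?_
    · filter_upwards [self_mem_nhdsWithin] with ε hε
      have := continuousOn_univ.mp (hmeasG ε (le_of_lt hε))
      refine Continuous.aestronglyMeasurable ?_
      exact Continuous.mul (by fun_prop) this
    · filter_upwards [Ioc_mem_nhdsGT (zero_lt_one (α := ℝ))] with ε hε
      filter_upwards [ae_restrict_mem measurableSet_Ioc] with t ht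
      have h1 := hM (ε, t) ⟨⟨hε.1.le, hε.2⟩, ⟨ht.1.le, ht.2⟩⟩
      rw [norm_mul, norm_mul, Complex.norm_real, Complex.norm_exp]
      have h2 : ‖1 - |t|‖ ≤ 1 := by
        have : |t| ≤ 1 := abs_le.mpr ⟨ht.1.le, ht.2⟩
        rw [Real.norm_eq_abs, abs_le]
        constructor <;> linarith [abs_nonneg t]
      have h3 : Real.exp ((Complex.I * (l * v) * t).re) = 1 := by simp
      rw [h3, mul_one]
      calc _ ≤ 1 * M := mul_le_mul h2 h1 (norm_nonneg _) zero_le_one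
        _ = M := one_mul M
    · exact integrable_const M
    · refine Eventually.of_forall fun t => ?_
      refine Tendsto.const_mul _ ?_
      have hc := GG_cont (Complex.I * l * t) (by simp)
      refine Tendsto.comp hc ?_
      refine tendsto_nhdsWithin_iff.mpr ⟨?_, ?_⟩
      · have : Continuous fun ε : ℝ => (ε : ℂ) + Complex.I * l * t := by fun_prop
        have h := this.tendsto 0
        simp only [Complex.ofReal_zero, zero_add] at h
        exact h.mono_left nhdsWithin_le_nhds
      · filter_upwards [self_mem_nhdsWithin] with ε hε
        simpa using le_of_lt hε
  refine tendsto_nhds_unique lim1 (lim2.congr' ?_)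
  filter_upwards [self_mem_nhdsWithin] with ε hε
  exact (smooth_eq hε hl v).symm

lemma conv_tendsto {l : ℝ} (hl : 0 < l) :
    Tendsto (fun v : ℝ => ∫ u in Ioi (0:ℝ), (aa u - 1) * KK (l * (v - u))) atTop (𝓝 0) := by
  have h1 : Tendsto (fun v : ℝ => ∫ u in Ioi (0:ℝ), ((aa u - 1 : ℝ) : ℂ) * (KK (l * (v - u)) : ℂ))
      atTop (𝓝 0) := by
    have RL := Real.tendsto_integral_exp_smul_cocompact
      ((Ioc (-1:ℝ) 1).indicator fun t : ℝ => ((1 - |t| : ℝ) : ℂ) * GG (Complex.I * l * t))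
    have hw : Tendsto (fun v : ℝ => -(l * v / (2 * Real.pi))) atTop (cocompact ℝ) := by
      refine Tendsto.mono_right ?_ atBot_le_cocompact
      refine tendsto_neg_atTop_atBot.comp ?_
      exact (tendsto_id.const_mul_atTop hl).atTop_div_const (by positivity)
    refine (RL.comp hw).congr fun v => ?_
    rw [smooth_eq0 hl v, ← integral_indicator measurableSet_Ioc]
    simp only [Function.comp]
    congr 1
    ext t
    by_cases ht : t ∈ Ioc (-1:ℝ) 1
    · rw [indicator_of_mem ht, indicator_of_mem ht, Circle.smul_def, Real.fourierChar_apply, smul_eq_mul]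
      have : ((2 * Real.pi * -(t * -(l * v / (2 * Real.pi))) : ℝ) : ℂ) * Complex.I =
          Complex.I * (l * v) * t := by
        have : (2 * Real.pi * -(t * -(l * v / (2 * Real.pi))) : ℝ) = l * v * t := by
          have := Real.pi_pos.ne'
          field_simp
        rw [this]; push_cast; ring
      rw [this]; ring
    · rw [indicator_of_notMem ht, indicator_of_notMem ht, smul_zero]
  have h2 := (Complex.continuous_re.tendsto 0).comp h1
  simp only [Complex.zero_re] at h2
  refine h2.congr fun v => ?_
  simp only [Function.comp]
  have : (∫ u in Ioi (0:ℝ), ((aa u - 1 : ℝ) : ℂ) * (KK (l * (v - u)) : ℂ)) =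
    ((∫ u in Ioi (0:ℝ), (aa u - 1) * KK (l * (v - u)) : ℝ) : ℂ) := by
    rw [← integral_complex_ofReal]
    push_cast; rfl
  rw [this, Complex.ofReal_re]
lemma int_kl {l : ℝ} (hl : 0 < l) : Integrable (fun y : ℝ => KK (l * y)) :=
  KK_int.comp_mul_left' hl.ne'

lemma int_aakl {l : ℝ} (hl : 0 < l) (v : ℝ) : Integrable (fun y : ℝ => aa (v - y) * KK (l * y)) := by
  refine Integrable.bdd_mul (c := Real.log 4 + 4) (int_kl hl)
    (aa_meas.comp (measurable_const.sub measurable_id)).aestronglyMeasurable ?_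
  refine Eventually.of_forall fun u => ?_
  rw [Real.norm_of_nonneg (aa_nonneg _)]
  exact aa_le _

lemma J_tendsto {l : ℝ} (hl : 0 < l) :
    Tendsto (fun v : ℝ => ∫ y, aa (v - y) * KK (l * y)) atTop (𝓝 (∫ y, KK (l * y))) := by
  have h1 : Tendsto (fun v : ℝ => ∫ y in Iic v, KK (l * y)) atTop (𝓝 (∫ y, KK (l * y))) :=
    (aecover_Iic (μ := volume) tendsto_id).integral_tendsto_of_countably_generated (int_kl hl)
  have h2 := (conv_tendsto hl).add h1
  rw [zero_add] at h2
  refine h2.congr fun v => ?_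
  have e1 : ∫ u in Ioi (0:ℝ), (aa u - 1) * KK (l * (v - u)) =
      ∫ y in Iic v, (aa (v - y) - 1) * KK (l * y) := by
    rw [integral_Iic_eq_integral_Iio, ← integral_indicator measurableSet_Ioi, ← integral_indicator measurableSet_Iio,
      ← integral_sub_left_eq_self _ volume v]
    congr 1
    ext y
    by_cases hy : y < v
    · rw [indicator_of_mem (by simpa using hy), indicator_of_mem (by simpa using hy)]
      simp
    · rw [indicator_of_notMem (by simpa using hy), indicator_of_notMem (by simpa using hy)]
  have e2 : ∫ y, aa (v - y) * KK (l * y) = ∫ y in Iic v, aa (v - y) * KK (l * y) := by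
    rw [setIntegral_eq_integral_of_forall_compl_eq_zero]
    intro y hy
    rw [aa_neg, zero_mul]
    simpa using hy
  rw [e1, e2, ← integral_add _ (int_kl hl).integrableOn]
  · congr 1; ext y; ring
  · have := ((int_aakl hl v).sub (int_kl hl)).integrableOn (s := Iic v)
    refine this.congr (Eventually.of_forall fun y => ?_)
    simp only [Pi.sub_apply]; ring

lemma exists_scale {h δ : ℝ} (hh : 0 < h) (hδ : 0 < δ) :
    ∃ l : ℝ, 0 < l ∧ (1 - δ) * ∫ y, KK (l * y) ≤ ∫ y in Icc (-h) h, KK (l * y) := by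
  have h1 : Tendsto (fun r : ℝ => ∫ y in Icc (-r) r, KK y) atTop (𝓝 (∫ y, KK y)) :=
    (aecover_Icc (μ := volume) tendsto_neg_atTop_atBot tendsto_id).integral_tendsto_of_countably_generated
      KK_int
  have h2 : (1 - δ) * ∫ y, KK y < ∫ y, KK y := by nlinarith [KK_pos]
  have h3 : Tendsto (fun l : ℝ => l * h) atTop atTop := tendsto_id.atTop_mul_const hh
  obtain ⟨l, hl, hl0⟩ := (((h1.comp h3).eventually (lt_mem_nhds h2)).and (eventually_gt_atTop 0)).exists
  refine ⟨l, hl0, ?_⟩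
  have e1 : ∫ y in Icc (-h) h, KK (l * y) = l⁻¹ * ∫ y in Icc (-(l * h)) (l * h), KK y := by
    rw [integral_Icc_eq_integral_Ioc, integral_Icc_eq_integral_Ioc,
      ← intervalIntegral.integral_of_le (by linarith),
      ← intervalIntegral.integral_of_le (by nlinarith),
      intervalIntegral.integral_comp_mul_left _ hl0.ne', smul_eq_mul, mul_neg]
  have e2 : ∫ y, KK (l * y) = l⁻¹ * ∫ y, KK y := by
    rw [Measure.integral_comp_mul_left, smul_eq_mul, abs_of_pos (inv_pos.mpr hl0)]
  rw [e1, e2]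
  have := mul_le_mul_of_nonneg_left hl.le (inv_pos.mpr hl0).le
  simp only [Function.comp] at this
  linarith

lemma kl_pos {l : ℝ} (hl : 0 < l) : 0 < ∫ y, KK (l * y) := by
  rw [Measure.integral_comp_mul_left, smul_eq_mul, abs_of_pos (inv_pos.mpr hl)]
  exact mul_pos (inv_pos.mpr hl) KK_pos

lemma aa_slow {u w : ℝ} (h : u ≤ w) : aa u ≤ Real.exp (w - u) * aa w := by
  have := aa_mono h
  simp only at this
  have h2 : aa u = (aa u * Real.exp u) * Real.exp (-u) := by rw [mul_assoc, ← Real.exp_add]; simp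
  rw [h2, sub_eq_add_neg, Real.exp_add]
  calc _ ≤ (aa w * Real.exp w) * Real.exp (-u) := mul_le_mul_of_nonneg_right this (Real.exp_pos _).le
    _ = _ := by ring

lemma upper {δ : ℝ} (hδ : 0 < δ) (hδ1 : δ < 1) :
    ∀ᶠ w in atTop, aa w ≤ Real.exp (2 * δ) * (1 + δ) / (1 - δ) := by
  obtain ⟨l, hl, hsc⟩ := exists_scale hδ hδ
  have hk := kl_pos hl
  have hlim := (J_tendsto hl).comp (tendsto_atTop_add_const_right atTop δ tendsto_id)
  have h2 : ∫ y, KK (l * y) < (1 + δ) * ∫ y, KK (l * y) := by nlinarith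
  filter_upwards [hlim.eventually (gt_mem_nhds h2)] with w hw
  simp only [Function.comp, id] at hw
  have h3 : ∫ y in Icc (-δ) δ, aa (w + δ - y) * KK (l * y) ≤ ∫ y, aa (w + δ - y) * KK (l * y) :=
    setIntegral_le_integral (int_aakl hl _)
      (Eventually.of_forall fun y => mul_nonneg (aa_nonneg _) (KK_nonneg _))
  have h4 : Real.exp (-(2 * δ)) * aa w * ∫ y in Icc (-δ) δ, KK (l * y) ≤
      ∫ y in Icc (-δ) δ, aa (w + δ - y) * KK (l * y) := by
    rw [← integral_const_mul]
    refine setIntegral_mono_on ((int_kl hl).const_mul _).integrableOn (int_aakl hl _).integrableOn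
      measurableSet_Icc fun y hy => ?_
    refine mul_le_mul_of_nonneg_right ?_ (KK_nonneg _)
    have := aa_slow (u := w) (w := w + δ - y) (by linarith [hy.2])
    have h5 : Real.exp (w + δ - y - w) ≤ Real.exp (2 * δ) := Real.exp_le_exp.mpr (by linarith [hy.1])
    have h6 : aa w ≤ Real.exp (2 * δ) * aa (w + δ - y) :=
      this.trans (mul_le_mul_of_nonneg_right h5 (aa_nonneg _))
    calc _ ≤ Real.exp (-(2 * δ)) * (Real.exp (2 * δ) * aa (w + δ - y)) :=
          mul_le_mul_of_nonneg_left h6 (Real.exp_pos _).le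
      _ = _ := by rw [← mul_assoc, ← Real.exp_add]; simp
  have h7 : Real.exp (-(2 * δ)) * aa w * ((1 - δ) * ∫ y, KK (l * y)) ≤
      (1 + δ) * ∫ y, KK (l * y) :=
    (mul_le_mul_of_nonneg_left hsc (mul_nonneg (Real.exp_pos _).le (aa_nonneg _))).trans
      (h4.trans (h3.trans hw.le))
  have h8 : Real.exp (-(2 * δ)) * aa w * (1 - δ) ≤ 1 + δ := by
    refine le_of_mul_le_mul_right ?_ hk
    linarith
  rw [le_div_iff₀ (by linarith)]
  calc aa w * (1 - δ) = Real.exp (2 * δ) * (Real.exp (-(2 * δ)) * aa w * (1 - δ)) := by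
        rw [← mul_assoc, ← mul_assoc, ← Real.exp_add]; simp
    _ ≤ _ := mul_le_mul_of_nonneg_left h8 (Real.exp_pos _).le

lemma lower {δ : ℝ} (hδ : 0 < δ) :
    ∀ᶠ w in atTop, Real.exp (-(2 * δ)) * (1 - δ - (Real.log 4 + 4) * δ) ≤ aa w := by
  obtain ⟨l, hl, hsc⟩ := exists_scale hδ hδ
  have hk := kl_pos hl
  have hlim := (J_tendsto hl).comp (tendsto_atTop_add_const_right atTop (-δ) tendsto_id)
  have h2 : (1 - δ) * ∫ y, KK (l * y) < ∫ y, KK (l * y) := by nlinarith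
  filter_upwards [hlim.eventually (lt_mem_nhds h2)] with w hw
  simp only [Function.comp, id] at hw
  have hC : 0 ≤ Real.log 4 + 4 := by
    have h4 := Real.log_nonneg (show (1:ℝ) ≤ 4 by norm_num)
    linarith
  have hsplit := integral_add_compl (measurableSet_Icc (a := -δ) (b := δ)) (int_aakl hl (w + -δ))
  have hsplit2 := integral_add_compl (measurableSet_Icc (a := -δ) (b := δ)) (int_kl hl)
  have h3 : ∫ y in (Icc (-δ) δ)ᶜ, aa (w + -δ - y) * KK (l * y) ≤
      (Real.log 4 + 4) * ∫ y in (Icc (-δ) δ)ᶜ, KK (l * y) := by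
    rw [← integral_const_mul]
    refine setIntegral_mono_on (int_aakl hl _).integrableOn ((int_kl hl).const_mul _).integrableOn
      measurableSet_Icc.compl fun y hy => ?_
    exact mul_le_mul_of_nonneg_right (aa_le _) (KK_nonneg _)
  have h4 : ∫ y in Icc (-δ) δ, aa (w + -δ - y) * KK (l * y) ≤
      Real.exp (2 * δ) * aa w * ∫ y in Icc (-δ) δ, KK (l * y) := by
    rw [← integral_const_mul]
    refine setIntegral_mono_on (int_aakl hl _).integrableOn ((int_kl hl).const_mul _).integrableOn
      measurableSet_Icc fun y hy => ?_
    refine mul_le_mul_of_nonneg_right ?_ (KK_nonneg _)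
    have := aa_slow (u := w + -δ - y) (w := w) (by linarith [hy.1])
    refine this.trans (mul_le_mul_of_nonneg_right ?_ (aa_nonneg _))
    exact Real.exp_le_exp.mpr (by linarith [hy.2])
  have h5 : ∫ y in Icc (-δ) δ, KK (l * y) ≤ ∫ y, KK (l * y) :=
    setIntegral_le_integral (int_kl hl) (Eventually.of_forall fun y => KK_nonneg _)
  have h6 : ∫ y in (Icc (-δ) δ)ᶜ, KK (l * y) ≤ δ * ∫ y, KK (l * y) := by linarith
  have h7 : (1 - δ) * ∫ y, KK (l * y) ≤ Real.exp (2 * δ) * aa w * (∫ y, KK (l * y)) +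
      (Real.log 4 + 4) * (δ * ∫ y, KK (l * y)) := by
    have a1 := mul_le_mul_of_nonneg_left h5 (mul_nonneg (Real.exp_pos (2 * δ)).le (aa_nonneg w))
    have a2 := mul_le_mul_of_nonneg_left h6 hC
    linarith
  have h8 : 1 - δ - (Real.log 4 + 4) * δ ≤ Real.exp (2 * δ) * aa w := by
    refine le_of_mul_le_mul_right ?_ hk
    linarith
  calc _ ≤ Real.exp (-(2 * δ)) * (Real.exp (2 * δ) * aa w) :=
        mul_le_mul_of_nonneg_left h8 (Real.exp_pos _).le
    _ = aa w := by rw [← mul_assoc, ← Real.exp_add]; simp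

lemma aa_tendsto : Tendsto aa atTop (𝓝 1) := by
  have cont1 : Tendsto (fun δ : ℝ => Real.exp (2 * δ) * (1 + δ) / (1 - δ)) (𝓝[>] 0) (𝓝 1) := by
    have : ContinuousAt (fun δ : ℝ => Real.exp (2 * δ) * (1 + δ) / (1 - δ)) 0 :=
      ContinuousAt.div (by fun_prop) (by fun_prop) (by norm_num)
    have h := this.tendsto
    simp only [mul_zero, Real.exp_zero, add_zero, sub_zero, one_mul, div_one] at h
    exact h.mono_left nhdsWithin_le_nhds
  have cont2 : Tendsto (fun δ : ℝ => Real.exp (-(2 * δ)) * (1 - δ - (Real.log 4 + 4) * δ))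
      (𝓝[>] 0) (𝓝 1) := by
    have : Continuous (fun δ : ℝ => Real.exp (-(2 * δ)) * (1 - δ - (Real.log 4 + 4) * δ)) := by
      fun_prop
    have h := this.tendsto 0
    simp only [mul_zero, neg_zero, Real.exp_zero, sub_zero, one_mul] at h
    exact h.mono_left nhdsWithin_le_nhds
  rw [tendsto_order]
  constructor
  · intro b hb
    obtain ⟨δ, h1, h2⟩ := ((cont2.eventually (lt_mem_nhds hb)).and self_mem_nhdsWithin).exists
    filter_upwards [lower h2] with w hw
    exact h1.trans_le hw
  · intro b hb
    obtain ⟨δ, h1, h2⟩ := ((cont1.eventually (gt_mem_nhds hb)).and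
      (Ioo_mem_nhdsGT (zero_lt_one (α := ℝ)))).exists
    filter_upwards [upper h2.1 h2.2] with w hw
    exact hw.trans_lt h1

/-- Prime number theorem for `ψ`. -/
lemma psi_tendsto : Tendsto (fun x : ℝ => Chebyshev.psi x / x) atTop (𝓝 1) := by
  refine (aa_tendsto.comp Real.tendsto_log_atTop).congr' ?_
  filter_upwards [eventually_gt_atTop 0] with x hx
  simp [aa, Real.exp_neg, Real.exp_log hx, div_eq_mul_inv]

/-- Prime number theorem for `θ`. -/
lemma theta_tendsto : Tendsto (fun x : ℝ => Chebyshev.theta x / x) atTop (𝓝 1) := by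
  have h1 : Tendsto (fun x : ℝ => (Chebyshev.psi x - Chebyshev.theta x) / x) atTop (𝓝 0) := by
    have h2 : (fun x : ℝ => Real.sqrt x) =o[atTop] fun x : ℝ => x := by
      refine Asymptotics.isLittleO_of_tendsto' ?_ ?_
      · filter_upwards [eventually_gt_atTop 0] with x hx h0
        exact absurd h0 hx.ne'
      · simp_rw [Real.sqrt_div_self']
        simp_rw [one_div]
        exact tendsto_inv_atTop_zero.comp Real.tendsto_sqrt_atTop
    exact (Chebyshev.isBigO_psi_sub_theta_sqrt.trans_isLittleO h2).tendsto_div_nhds_zero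
  have := psi_tendsto.sub h1
  rw [sub_zero] at this
  refine this.congr fun x => ?_
  ring
/-! Tail sums over primes -/

noncomputable def cc (n : ℕ) : ℝ := if n.Prime then Real.log n else 0

lemma cc_sum (t : ℝ) : ∑ k ∈ Finset.Icc 0 ⌊t⌋₊, cc k = Chebyshev.theta t := by
  rw [Chebyshev.theta_eq_sum_Icc, Finset.sum_filter]; rfl

noncomputable def TT (a b : ℝ) : ℝ :=
  ∑ k ∈ Finset.Ioc ⌊a⌋₊ ⌊b⌋₊, (k : ℝ) ^ (-(4:ℝ)/3) * cc k

lemma TT_eq {a b : ℝ} (ha : 0 < a) (hab : a ≤ b) :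
    IntegrableOn (fun t => t ^ (-(7:ℝ)/3) * Chebyshev.theta t) (Ioc a b) ∧
    TT a b = b ^ (-(4:ℝ)/3) * Chebyshev.theta b - a ^ (-(4:ℝ)/3) * Chebyshev.theta a +
      (4/3) * ∫ t in Ioc a b, t ^ (-(7:ℝ)/3) * Chebyshev.theta t := by
  have hd : ∀ t ∈ Icc a b, HasDerivAt (fun t : ℝ => t ^ (-(4:ℝ)/3)) (-(4/3) * t ^ (-(7:ℝ)/3)) t := by
    intro t ht
    have := Real.hasDerivAt_rpow_const (x := t) (p := -(4:ℝ)/3) (Or.inl (ha.trans_le ht.1).ne')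
    convert! this using 1
    norm_num
  have hcont : ContinuousOn (fun t : ℝ => t ^ (-(7:ℝ)/3)) (Icc a b) := by
    intro t ht
    exact (Real.continuousAt_rpow_const _ _ (Or.inl (ha.trans_le ht.1).ne')).continuousWithinAt
  constructor
  · have h := hcont.integrableOn_Icc (μ := volume)
    have h2 := integrableOn_mul_sum_Icc (m := 0) (b := b) cc ha.le h
    simp_rw [cc_sum] at h2
    exact h2.mono_set Ioc_subset_Icc_self
  · have := sum_mul_eq_sub_sub_integral_mul cc ha.le hab (fun t ht => (hd t ht).differentiableAt) ?_
    · rw [TT, this, cc_sum, cc_sum]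
      have e : ∫ t in Ioc a b, deriv (fun t : ℝ => t ^ (-(4:ℝ)/3)) t * ∑ k ∈ Finset.Icc 0 ⌊t⌋₊, cc k =
          -(4/3) * ∫ t in Ioc a b, t ^ (-(7:ℝ)/3) * Chebyshev.theta t := by
        rw [← integral_const_mul]
        refine setIntegral_congr_fun measurableSet_Ioc fun t ht => ?_
        rw [(hd t (Ioc_subset_Icc_self ht)).deriv, cc_sum]; ring
      rw [e]; ring
    · have h3 : ContinuousOn (fun t : ℝ => -(4/3) * t ^ (-(7:ℝ)/3)) (Icc a b) :=
        continuousOn_const.mul hcont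
      refine (h3.integrableOn_Icc (μ := volume)).congr_fun (fun t ht => ?_) measurableSet_Icc
      exact (hd t ht).deriv.symm

lemma int_rpow {a b : ℝ} (ha : 0 < a) (hab : a ≤ b) :
    IntegrableOn (fun t : ℝ => t ^ (-(4:ℝ)/3)) (Ioc a b) ∧
    ∫ t in Ioc a b, t ^ (-(4:ℝ)/3) = 3 * (a ^ (-(1:ℝ)/3) - b ^ (-(1:ℝ)/3)) := by
  constructor
  · have hcont : ContinuousOn (fun t : ℝ => t ^ (-(4:ℝ)/3)) (Icc a b) := by
      intro t ht
      exact (Real.continuousAt_rpow_const _ _ (Or.inl (ha.trans_le ht.1).ne')).continuousWithinAt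
    exact (hcont.integrableOn_Icc (μ := volume)).mono_set Ioc_subset_Icc_self
  · rw [← intervalIntegral.integral_of_le hab, integral_rpow]
    · norm_num; ring
    · right
      refine ⟨by norm_num, ?_⟩
      rw [uIcc_of_le hab]
      intro h
      linarith [h.1]

lemma rpow_aux {t : ℝ} (ht : 0 < t) : t ^ (-(4:ℝ)/3) * t = t ^ (-(1:ℝ)/3) := by
  nth_rw 2 [← Real.rpow_one t]
  rw [← Real.rpow_add ht]; norm_num

lemma rpow_aux2 {t : ℝ} (ht : 0 < t) : t ^ (-(7:ℝ)/3) * t = t ^ (-(4:ℝ)/3) := by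
  nth_rw 2 [← Real.rpow_one t]
  rw [← Real.rpow_add ht]; norm_num

lemma TT_bound {ε : ℝ} (hε : 0 < ε) : ∀ᶠ a in atTop, ∀ b, a ≤ b →
    |TT a b - 3 * (a ^ (-(1:ℝ)/3) - b ^ (-(1:ℝ)/3))| ≤ 5 * ε * a ^ (-(1:ℝ)/3) := by
  have h1 : ∀ᶠ x in atTop, |Chebyshev.theta x / x - 1| < ε := by
    have := (Metric.tendsto_nhds.mp theta_tendsto) ε hε
    simpa [Real.dist_eq] using this
  obtain ⟨A, hA⟩ := eventually_atTop.mp h1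
  filter_upwards [eventually_ge_atTop A, eventually_gt_atTop 0] with a haA ha b hab
  have hth : ∀ t, a ≤ t → (1 - ε) * t ≤ Chebyshev.theta t ∧ Chebyshev.theta t ≤ (1 + ε) * t := by
    intro t ht
    have ht0 : 0 < t := ha.trans_le ht
    have := abs_lt.mp (hA t (haA.trans ht))
    have e : Chebyshev.theta t = (Chebyshev.theta t / t) * t := by field_simp
    rw [e]
    constructor <;> refine mul_le_mul_of_nonneg_right ?_ ht0.le <;> linarith
  obtain ⟨i1, e1⟩ := TT_eq ha hab
  obtain ⟨i2, e2⟩ := int_rpow ha hab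
  have hb : 0 < b := ha.trans_le hab
  have hI1 : (1 - ε) * ∫ t in Ioc a b, t ^ (-(4:ℝ)/3) ≤
      ∫ t in Ioc a b, t ^ (-(7:ℝ)/3) * Chebyshev.theta t := by
    rw [← integral_const_mul]
    refine setIntegral_mono_on (i2.const_mul _) i1 measurableSet_Ioc fun t ht => ?_
    have ht0 : 0 < t := ha.trans ht.1
    rw [← rpow_aux2 ht0]
    have := mul_le_mul_of_nonneg_left (hth t ht.1.le).1 (Real.rpow_nonneg ht0.le (-(7:ℝ)/3))
    linarith
  have hI2 : ∫ t in Ioc a b, t ^ (-(7:ℝ)/3) * Chebyshev.theta t ≤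
      (1 + ε) * ∫ t in Ioc a b, t ^ (-(4:ℝ)/3) := by
    rw [← integral_const_mul]
    refine setIntegral_mono_on i1 (i2.const_mul _) measurableSet_Ioc fun t ht => ?_
    have ht0 : 0 < t := ha.trans ht.1
    rw [← rpow_aux2 ht0]
    have := mul_le_mul_of_nonneg_left (hth t ht.1.le).2 (Real.rpow_nonneg ht0.le (-(7:ℝ)/3))
    linarith
  rw [e2] at hI1 hI2
  have p1 := mul_le_mul_of_nonneg_left (hth a le_rfl).1 (Real.rpow_nonneg ha.le (-(4:ℝ)/3))
  have p2 := mul_le_mul_of_nonneg_left (hth a le_rfl).2 (Real.rpow_nonneg ha.le (-(4:ℝ)/3))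
  have p3 := mul_le_mul_of_nonneg_left (hth b hab).1 (Real.rpow_nonneg hb.le (-(4:ℝ)/3))
  have p4 := mul_le_mul_of_nonneg_left (hth b hab).2 (Real.rpow_nonneg hb.le (-(4:ℝ)/3))
  have q1 := rpow_aux ha
  have q2 := rpow_aux hb
  rw [show a ^ (-(4:ℝ)/3) * ((1 - ε) * a) = (1 - ε) * (a ^ (-(4:ℝ)/3) * a) by ring, q1] at p1
  rw [show a ^ (-(4:ℝ)/3) * ((1 + ε) * a) = (1 + ε) * (a ^ (-(4:ℝ)/3) * a) by ring, q1] at p2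
  rw [show b ^ (-(4:ℝ)/3) * ((1 - ε) * b) = (1 - ε) * (b ^ (-(4:ℝ)/3) * b) by ring, q2] at p3
  rw [show b ^ (-(4:ℝ)/3) * ((1 + ε) * b) = (1 + ε) * (b ^ (-(4:ℝ)/3) * b) by ring, q2] at p4
  have r1 : 0 ≤ ε * b ^ (-(1:ℝ)/3) := mul_nonneg hε.le (Real.rpow_nonneg hb.le _)
  rw [e1, abs_le]
  constructor <;> nlinarith

noncomputable def gg (Y : ℝ) (n : ℕ) : ℝ :=
  if n.Prime ∧ Y < n then (n : ℝ) ^ (-(4:ℝ)/3) else 0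

lemma gg_nonneg (Y : ℝ) (n : ℕ) : 0 ≤ gg Y n := by
  unfold gg; split_ifs
  · positivity
  · exact le_rfl

lemma gg_summable (Y : ℝ) : Summable (gg Y) := by
  refine Summable.of_nonneg_of_le (gg_nonneg Y) (fun n => ?_)
    (Real.summable_nat_rpow.mpr (show (-(4:ℝ)/3) < -1 by norm_num))
  unfold gg; split_ifs
  · exact le_rfl
  · positivity

noncomputable def SS (Y : ℝ) : ℝ := ∑' n, gg Y n

lemma gg_upper {Y : ℝ} (hY : 1 < Y) (n : ℕ) :
    gg Y n * Real.log Y ≤ (n : ℝ) ^ (-(4:ℝ)/3) * cc n := by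
  unfold gg cc
  by_cases hp : n.Prime
  · by_cases h : Y < n
    · simp only [hp, h, and_self, if_true]
      exact mul_le_mul_of_nonneg_left (Real.log_le_log (by linarith) h.le) (by positivity)
    · simp only [hp, h, and_false, if_false, if_true, zero_mul]
      have := Real.log_natCast_nonneg n
      positivity
  · simp [hp]

lemma gg_lower {Y N : ℝ} (hY : 1 < Y) {n : ℕ} (h : Y < n) (hN : n ≤ N) :
    (n : ℝ) ^ (-(4:ℝ)/3) * cc n ≤ gg Y n * Real.log N := by
  unfold gg cc
  by_cases hp : n.Prime
  · simp only [hp, h, and_self, if_true]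
    exact mul_le_mul_of_nonneg_left (Real.log_le_log (by linarith) hN) (by positivity)
  · simp [hp]

lemma TT_term_nonneg (n : ℕ) : 0 ≤ (n : ℝ) ^ (-(4:ℝ)/3) * cc n := by
  refine mul_nonneg (by positivity) ?_
  unfold cc; split_ifs
  · exact Real.log_natCast_nonneg n
  · exact le_rfl

lemma SS_upper {Y M : ℝ} (hY : 1 < Y) (hM : ∀ b, Y ≤ b → TT Y b ≤ M) : SS Y * Real.log Y ≤ M := by
  have hl : 0 < Real.log Y := Real.log_pos hY
  rw [← le_div_iff₀ hl]
  refine Real.tsum_le_of_sum_range_le (gg_nonneg Y) fun n => ?_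
  rw [le_div_iff₀ hl, Finset.sum_mul]
  refine le_trans ?_ (hM (max Y n) (le_max_left _ _))
  unfold TT
  have : ∑ i ∈ Finset.range n, gg Y i * Real.log Y =
      ∑ i ∈ Finset.range n with Y < ((i : ℕ) : ℝ), gg Y i * Real.log Y := by
    rw [Finset.sum_filter]
    refine Finset.sum_congr rfl fun i _ => ?_
    split_ifs with h
    · rfl
    · simp [gg, h]
  rw [this]
  refine (Finset.sum_le_sum fun i _ => gg_upper hY i).trans ?_
  refine Finset.sum_le_sum_of_subset_of_nonneg ?_ fun i _ _ => TT_term_nonneg i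
  intro i hi
  simp only [Finset.mem_filter, Finset.mem_range] at hi
  rw [Finset.mem_Ioc]
  refine ⟨(Nat.floor_lt (by linarith)).mpr hi.2, Nat.le_floor ?_⟩
  refine le_trans ?_ (le_max_right _ _)
  exact_mod_cast hi.1.le

lemma SS_lower {Y N : ℝ} (hY : 1 < Y) (hN : Y ≤ N) : TT Y N ≤ SS Y * Real.log N := by
  have hl : 0 ≤ Real.log N := Real.log_nonneg (by linarith)
  have h1 : TT Y N ≤ (∑ n ∈ Finset.Ioc ⌊Y⌋₊ ⌊N⌋₊, gg Y n) * Real.log N := by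
    rw [TT, Finset.sum_mul]
    refine Finset.sum_le_sum fun n hn => ?_
    rw [Finset.mem_Ioc] at hn
    exact gg_lower hY ((Nat.floor_lt (by linarith)).mp hn.1) ((Nat.le_floor_iff (by linarith)).mp hn.2)
  exact h1.trans (mul_le_mul_of_nonneg_right
    ((gg_summable Y).sum_le_tsum _ fun n _ => gg_nonneg Y n) hl)

lemma rpow_cancel {Y : ℝ} (hY : 0 < Y) : Y ^ ((1:ℝ)/3) * Y ^ (-(1:ℝ)/3) = 1 := by
  rw [← Real.rpow_add hY]; norm_num

lemma SS_tendsto : Tendsto (fun Y : ℝ => Y ^ ((1:ℝ)/3) * Real.log Y * SS Y) atTop (𝓝 3) := by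
  have key : ∀ ε : ℝ, 0 < ε → ε < 1/8 → ∀ᶠ Y in atTop,
      3 - 9 * ε ≤ Y ^ ((1:ℝ)/3) * Real.log Y * SS Y ∧ Y ^ ((1:ℝ)/3) * Real.log Y * SS Y ≤ 3 + 5 * ε := by
    intro ε hε hε1
    set A : ℝ := (ε⁻¹) ^ 3 with hA
    have hA1 : 1 ≤ A := one_le_pow₀ ((one_le_inv₀ hε).mpr (by linarith))
    have hA0 : 0 < A := by linarith
    have hAr : A ^ (-(1:ℝ)/3) = ε := by
      rw [hA, ← Real.rpow_natCast, ← Real.rpow_mul (by positivity)]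
      norm_num
      rw [Real.rpow_neg_one, inv_inv]
    have hlog : Tendsto (fun Y : ℝ => (3 - 8 * ε) * (Real.log Y / (Real.log Y + Real.log A))) atTop
        (𝓝 (3 - 8 * ε)) := by
      have : Tendsto (fun Y : ℝ => 1 - Real.log A / (Real.log Y + Real.log A)) atTop (𝓝 (1 - 0)) :=
        tendsto_const_nhds.sub (tendsto_const_nhds.div_atTop
          (tendsto_atTop_add_const_right _ _ Real.tendsto_log_atTop))
      rw [sub_zero] at this
      have h2 := this.const_mul (3 - 8 * ε)
      rw [mul_one] at h2
      refine h2.congr' ?_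
      filter_upwards [eventually_gt_atTop 1] with Y hY
      have h3 : 0 < Real.log Y := Real.log_pos hY
      have h4 : 0 ≤ Real.log A := Real.log_nonneg hA1
      have : Real.log Y + Real.log A ≠ 0 := by linarith
      field_simp
      ring
    filter_upwards [TT_bound hε, eventually_gt_atTop 1,
      hlog.eventually (lt_mem_nhds (show 3 - 9 * ε < 3 - 8 * ε by linarith))] with Y hT hY hr
    have hY0 : 0 < Y := by linarith
    have hw : 0 < Y ^ ((1:ℝ)/3) := Real.rpow_pos_of_pos hY0 _
    have hc := rpow_cancel hY0
    constructor
    · have hYA : Y ≤ Y * A := le_mul_of_one_le_right hY0.le hA1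
      have h1 := (abs_le.mp (hT (Y * A) hYA)).1
      rw [Real.mul_rpow hY0.le hA0.le, hAr] at h1
      have h2 := SS_lower hY hYA
      rw [Real.log_mul hY0.ne' hA0.ne'] at h2
      have h3 : 0 < Real.log Y := Real.log_pos hY
      have h4 : 0 ≤ Real.log A := Real.log_nonneg hA1
      have h5 : (3 - 8 * ε) * Y ^ (-(1:ℝ)/3) ≤ SS Y * (Real.log Y + Real.log A) := by linarith
      have h6 : 3 - 8 * ε ≤ Y ^ ((1:ℝ)/3) * (SS Y * (Real.log Y + Real.log A)) := by
        have := mul_le_mul_of_nonneg_left h5 hw.le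
        calc 3 - 8 * ε = (3 - 8 * ε) * (Y ^ ((1:ℝ)/3) * Y ^ (-(1:ℝ)/3)) := by rw [hc, mul_one]
          _ = Y ^ ((1:ℝ)/3) * ((3 - 8 * ε) * Y ^ (-(1:ℝ)/3)) := by ring
          _ ≤ _ := this
      have h7 : 0 < Real.log Y + Real.log A := by linarith
      calc 3 - 9 * ε ≤ (3 - 8 * ε) * (Real.log Y / (Real.log Y + Real.log A)) := hr.le
        _ ≤ (Y ^ ((1:ℝ)/3) * (SS Y * (Real.log Y + Real.log A))) *
            (Real.log Y / (Real.log Y + Real.log A)) :=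
          mul_le_mul_of_nonneg_right h6 (div_nonneg h3.le h7.le)
        _ = _ := by field_simp
    · have h1 : SS Y * Real.log Y ≤ (3 + 5 * ε) * Y ^ (-(1:ℝ)/3) := by
        refine SS_upper hY fun b hb => ?_
        have := (abs_le.mp (hT b hb)).2
        have h0 : 0 ≤ b ^ (-(1:ℝ)/3) := Real.rpow_nonneg (hY0.le.trans hb) _
        linarith
      calc Y ^ ((1:ℝ)/3) * Real.log Y * SS Y = Y ^ ((1:ℝ)/3) * (SS Y * Real.log Y) := by ring
        _ ≤ Y ^ ((1:ℝ)/3) * ((3 + 5 * ε) * Y ^ (-(1:ℝ)/3)) := mul_le_mul_of_nonneg_left h1 hw.le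
        _ = (3 + 5 * ε) * (Y ^ ((1:ℝ)/3) * Y ^ (-(1:ℝ)/3)) := by ring
        _ = _ := by rw [hc, mul_one]
  rw [Metric.tendsto_nhds]
  intro η hη
  have hm : 0 < min (η / 10) (1/9) := by positivity
  have hm1 : min (η / 10) (1/9) ≤ η / 10 := min_le_left _ _
  have hm2 : min (η / 10) (1/9) ≤ (1/9 : ℝ) := min_le_right _ _
  filter_upwards [key _ hm (by linarith)] with Y hY
  rw [Real.dist_eq, abs_lt]
  constructor <;> linarith [hY.1, hY.2]

/-! The product -/

noncomputable def al (Y : ℝ) (p : Nat.Primes) : ℝ :=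
  if Y < ((p : ℕ) : ℝ) then ((p : ℕ) : ℝ) ^ (-(4:ℝ)/3) /
    (1 + ((p : ℕ) : ℝ)⁻¹ + ((p : ℕ) : ℝ) ^ (-(4:ℝ)/3)) else 0

lemma factor_eq (Y : ℝ) (p : Nat.Primes) :
    (if Y < ((p : ℕ) : ℝ) then (1 + ((p : ℕ) : ℝ)⁻¹) /
      (1 + ((p : ℕ) : ℝ)⁻¹ + ((p : ℕ) : ℝ) ^ (-(4:ℝ)/3)) else 1) = 1 - al Y p := by
  unfold al
  have : (0:ℝ) < 1 + ((p : ℕ) : ℝ)⁻¹ + ((p : ℕ) : ℝ) ^ (-(4:ℝ)/3) := by positivity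
  split_ifs
  · field_simp; ring
  · simp

lemma al_nonneg (Y : ℝ) (p : Nat.Primes) : 0 ≤ al Y p := by
  unfold al; split_ifs
  · positivity
  · exact le_rfl

lemma gg_prime (Y : ℝ) (p : Nat.Primes) :
    gg Y p = if Y < ((p : ℕ) : ℝ) then ((p : ℕ) : ℝ) ^ (-(4:ℝ)/3) else 0 := by
  simp [gg, p.2]

lemma al_le (Y : ℝ) (p : Nat.Primes) : al Y p ≤ gg Y p := by
  rw [gg_prime]; unfold al; split_ifs
  · refine div_le_self (by positivity) ?_
    have h1 : (0:ℝ) ≤ ((p : ℕ) : ℝ)⁻¹ := by positivity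
    have h2 : (0:ℝ) ≤ ((p : ℕ) : ℝ) ^ (-(4:ℝ)/3) := by positivity
    linarith
  · exact le_rfl

lemma al_le_one (Y : ℝ) (p : Nat.Primes) : al Y p ≤ 1 := by
  unfold al; split_ifs
  · have h1 : (0:ℝ) ≤ ((p : ℕ) : ℝ)⁻¹ := by positivity
    rw [div_le_one (by positivity)]
    linarith
  · exact zero_le_one

lemma al_ge {Y : ℝ} (hY : 1 < Y) (p : Nat.Primes) : gg Y p * (1 + 2 / Y)⁻¹ ≤ al Y p := by
  rw [gg_prime]; unfold al; split_ifs with h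
  · rw [← div_eq_mul_inv]
    have hp : (1:ℝ) < ((p : ℕ) : ℝ) := hY.trans h
    have h1 : ((p : ℕ) : ℝ)⁻¹ ≤ Y⁻¹ := inv_anti₀ (by linarith) h.le
    have h2 : ((p : ℕ) : ℝ) ^ (-(4:ℝ)/3) ≤ ((p : ℕ) : ℝ)⁻¹ := by
      rw [← Real.rpow_neg_one]
      exact Real.rpow_le_rpow_of_exponent_le hp.le (by norm_num)
    refine div_le_div_of_nonneg_left (by positivity) (by positivity) ?_
    have e : 2 / Y = 2 * Y⁻¹ := div_eq_mul_inv _ _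
    rw [e]; linarith
  · simp

lemma SS_eq (Y : ℝ) : Summable (fun p : Nat.Primes => gg Y p) ∧ ∑' p : Nat.Primes, gg Y p = SS Y := by
  constructor
  · exact (gg_summable Y).subtype {p : ℕ | p.Prime}
  · have : ∑' p : Nat.Primes, gg Y p = ∑' n, ({p : ℕ | p.Prime} : Set ℕ).indicator (gg Y) n :=
      tsum_subtype {p : ℕ | p.Prime} (gg Y)
    rw [this, SS]
    congr 1; ext n
    by_cases hn : n.Prime
    · rw [indicator_of_mem (by exact hn)]
    · rw [indicator_of_notMem (by exact hn)]
      simp [gg, hn]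

lemma prod_ge {ι : Type*} (s : Finset ι) (f : ι → ℝ) (h0 : ∀ i, 0 ≤ f i) (h1 : ∀ i, f i ≤ 1) :
    1 - ∑ i ∈ s, f i ≤ ∏ i ∈ s, (1 - f i) := by
  induction s using Finset.induction_on with
  | empty => simp
  | insert a s ha ih =>
    rw [Finset.sum_insert ha, Finset.prod_insert ha]
    have h2 : 0 ≤ ∑ i ∈ s, f i := Finset.sum_nonneg fun i _ => h0 i
    have h3 : 0 ≤ (1 - f a) := by linarith [h1 a]
    have := mul_le_mul_of_nonneg_left ih h3
    nlinarith [h0 a]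

lemma prod_le {ι : Type*} (s : Finset ι) (f : ι → ℝ) (h1 : ∀ i, f i ≤ 1) :
    ∏ i ∈ s, (1 - f i) ≤ Real.exp (-∑ i ∈ s, f i) := by
  rw [← Finset.sum_neg_distrib, Real.exp_sum]
  refine Finset.prod_le_prod (fun i _ => by linarith [h1 i]) fun i _ => ?_
  have := Real.add_one_le_exp (-f i)
  linarith

lemma PP_bounds {Y : ℝ} (hY : 1 < Y) :
    SS Y * ((1 + 2 / Y)⁻¹ * (1 + SS Y)⁻¹) ≤ 1 - ∏' p : Nat.Primes, (1 - al Y p) ∧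
    1 - ∏' p : Nat.Primes, (1 - al Y p) ≤ SS Y := by
  obtain ⟨hs, he⟩ := SS_eq Y
  have hal : Summable (al Y) := Summable.of_nonneg_of_le (al_nonneg Y) (al_le Y) hs
  have hmul : Multipliable fun p : Nat.Primes => 1 + (-al Y p) :=
    multipliable_one_add_of_summable (by
      refine hal.congr fun p => ?_
      rw [norm_neg, Real.norm_of_nonneg (al_nonneg Y p)])
  simp only [← sub_eq_add_neg] at hmul
  have hprod := hmul.hasProd
  have hsum := hal.hasSum
  have b1 : 1 - ∑' p, al Y p ≤ ∏' p : Nat.Primes, (1 - al Y p) :=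
    le_of_tendsto_of_tendsto' (tendsto_const_nhds.sub hsum) hprod
      fun s => prod_ge s _ (al_nonneg Y) (al_le_one Y)
  have b2 : ∏' p : Nat.Primes, (1 - al Y p) ≤ Real.exp (-∑' p, al Y p) :=
    le_of_tendsto_of_tendsto' hprod ((Real.continuous_exp.tendsto _).comp hsum.neg)
      fun s => by simpa using prod_le s _ (al_le_one Y)
  have c1 : ∑' p, al Y p ≤ SS Y := by
    rw [← he]; exact hal.tsum_le_tsum (al_le Y) hs
  have c2 : SS Y * (1 + 2 / Y)⁻¹ ≤ ∑' p, al Y p := by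
    rw [← he, ← tsum_mul_right]
    exact (hs.mul_right _).tsum_le_tsum (al_ge hY) hal
  refine ⟨?_, by linarith⟩
  set x := ∑' p, al Y p with hx
  have hx0 : 0 ≤ x := tsum_nonneg (al_nonneg Y)
  have d1 : Real.exp (-x) ≤ (1 + x)⁻¹ := by
    rw [Real.exp_neg]
    exact inv_anti₀ (by linarith) (by linarith [Real.add_one_le_exp x])
  have d2 : 1 - (1 + x)⁻¹ = x * (1 + x)⁻¹ := by
    have : 1 + x ≠ 0 := by linarith
    field_simp; ring
  calc SS Y * ((1 + 2 / Y)⁻¹ * (1 + SS Y)⁻¹) = (SS Y * (1 + 2 / Y)⁻¹) * (1 + SS Y)⁻¹ := by ring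
    _ ≤ x * (1 + x)⁻¹ := by
      refine mul_le_mul c2 (inv_anti₀ (by linarith) (by linarith)) ?_ hx0
      exact inv_nonneg.mpr (by linarith)
    _ ≤ _ := by rw [← d2]; linarith

lemma PP_tendsto : Tendsto (fun Y : ℝ => Y ^ ((1:ℝ)/3) * Real.log Y *
    (1 - ∏' p : Nat.Primes, (1 - al Y p))) atTop (𝓝 3) := by
  have hw : Tendsto (fun Y : ℝ => Y ^ ((1:ℝ)/3) * Real.log Y) atTop atTop :=
    (tendsto_rpow_atTop (by norm_num)).atTop_mul_atTop₀ Real.tendsto_log_atTop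
  have hS0 : Tendsto SS atTop (𝓝 0) := by
    refine (SS_tendsto.div_atTop hw).congr' ?_
    filter_upwards [hw.eventually_gt_atTop 0] with Y hY
    rw [mul_div_cancel_left₀ _ hY.ne']
  have h1 : Tendsto (fun Y : ℝ => (1 + 2 / Y)⁻¹ * (1 + SS Y)⁻¹) atTop (𝓝 ((1 + 0)⁻¹ * (1 + 0)⁻¹)) := by
    refine Tendsto.mul (Tendsto.inv₀ (tendsto_const_nhds.add
      (tendsto_const_nhds.div_atTop tendsto_id)) (by norm_num))
      (Tendsto.inv₀ (tendsto_const_nhds.add hS0) (by norm_num))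
  have h2 := SS_tendsto.mul h1
  norm_num at h2
  refine tendsto_of_tendsto_of_tendsto_of_le_of_le' h2 SS_tendsto ?_ ?_
  · filter_upwards [eventually_gt_atTop 1, hw.eventually_ge_atTop 0] with Y hY hY2
    have := mul_le_mul_of_nonneg_left (PP_bounds hY).1 hY2
    norm_num at this ⊢
    linarith
  · filter_upwards [eventually_gt_atTop 1, hw.eventually_ge_atTop 0] with Y hY hY2
    exact mul_le_mul_of_nonneg_left (PP_bounds hY).2 hY2

end TPM

theorem tail_product_main_term :
    Tendsto (fun X : ℝ =>
      X ^ ((1:ℝ)/12) * Real.log X *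
        (1 - ∏' p : Nat.Primes,
          (if X ^ ((1:ℝ)/4) < ((p : ℕ) : ℝ) then
            (1 + ((p : ℕ) : ℝ)⁻¹) /
              (1 + ((p : ℕ) : ℝ)⁻¹ + ((p : ℕ) : ℝ) ^ (-(4:ℝ)/3))
          else 1)))
      atTop (nhds 12) := by
  have h := (TPM.PP_tendsto.comp (tendsto_rpow_atTop (show (0:ℝ) < 1/4 by norm_num))).const_mul 4
  norm_num only at h
  refine h.congr' ?_
  filter_upwards [eventually_gt_atTop 0] with X hX
  simp only [Function.comp, TPM.factor_eq]
  rw [Real.log_rpow hX, ← Real.rpow_mul hX.le]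
  norm_num only
  ring
end

section
/- As X → ∞, the product over primes p > X^{1/4} of (1 + p^{−2/3} + p⁻¹ + p^{−4/3})/(1 + p^{−2/3} + p⁻¹ + p^{−4/3} + p^{−13/9}) equals 1 − (9 + o(1))·X^{−1/9}/log X; that is, lim_{X→∞} X^{1/9}·(log X)·(1 − ∏_{p > X^{1/4}} (1 + p^{−2/3} + p⁻¹ + p^{−4/3})/(1 + p^{−2/3} + p⁻¹ + p^{−4/3} + p^{−13/9})) = 9. -/
open Filter
open scoped Classical


open MeasureTheory Topology Set in
theorem aux_wiener (b : ℝ → ℝ) (hbm : Measurable b) (C : ℝ) (hb : ∀ t, |b t| ≤ C)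
    (H : ℂ → ℂ) (hH : ContinuousOn H {s | 0 ≤ s.re})
    (hL : ∀ s : ℂ, 0 < s.re → ∫ t in Ioi (0:ℝ), (b t : ℂ) * Complex.exp (-s * t) = H s)
    (φ : ℝ → ℝ) (hφ : Continuous φ) (R : ℝ) (hR : ∀ y, R < |y| → φ y = 0)
    (k : ℝ → ℝ) (hk : Integrable k)
    (hkφ : ∀ x : ℝ, ∫ y : ℝ, (φ y : ℂ) * Complex.exp (Complex.I * y * x) = k x) :
    Tendsto (fun x : ℝ => ∫ t in Ioi (0:ℝ), b t * k (x - t)) atTop (𝓝 0) := by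
  have hsupp : HasCompactSupport φ := by
    refine HasCompactSupport.of_support_subset_isCompact (isCompact_Icc (a := -R) (b := R)) ?_
    intro y hy
    by_contra h
    refine hy (hR y ?_)
    by_contra h2
    exact h (abs_le.1 (not_lt.1 h2))
  have hφi : Integrable φ := hφ.integrable_of_hasCompactSupport hsupp
  have key : ∀ δ : ℝ, 0 < δ → ∀ x : ℝ,
      ∫ t in Ioi (0:ℝ), (b t : ℂ) * Complex.exp (-δ * t) * k (x - t) =
      ∫ y : ℝ, (φ y : ℂ) * Complex.exp (Complex.I * y * x) * H (δ + Complex.I * y) := by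
    intro δ hδ x
    have h1 : ∀ t : ℝ, (b t : ℂ) * Complex.exp (-δ * t) * k (x - t) =
        ∫ y : ℝ, ((b t : ℂ) * Complex.exp (-δ * t)) * ((φ y : ℂ) * Complex.exp (Complex.I * y * (x - t))) := by
      intro t
      rw [← hkφ, integral_const_mul]
      push_cast
      rfl
    simp_rw [h1]
    rw [integral_integral_swap]
    · refine integral_congr_ae (Eventually.of_forall fun y => ?_)
      simp only
      rw [← hL (δ + Complex.I * y) (by simpa using hδ), ← integral_const_mul]
      refine integral_congr_ae (Eventually.of_forall fun t => ?_)
      simp only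
      have : Complex.exp (-δ * t) * Complex.exp (Complex.I * y * (x - t)) =
        Complex.exp (Complex.I * y * x) * Complex.exp (-(δ + Complex.I * y) * t) := by
        rw [← Complex.exp_add, ← Complex.exp_add]; congr 1; ring
      linear_combination (b t : ℂ) * φ y * this
    · have hi1 : Integrable (fun t : ℝ => C * Real.exp (-δ * t)) (volume.restrict (Ioi 0)) :=
        (exp_neg_integrableOn_Ioi 0 hδ).const_mul C
      have hi2 : Integrable (fun y : ℝ => ‖φ y‖) := hφi.norm
      refine (hi1.mul_prod hi2).mono' ?_ (Eventually.of_forall ?_)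
      · refine Measurable.aestronglyMeasurable ?_
        have := hφ.measurable
        unfold Function.uncurry
        fun_prop
      · rintro ⟨t, y⟩
        have e1 : ‖Complex.exp (-δ * t)‖ = Real.exp (-δ * t) := by
          rw [Complex.norm_exp]; simp
        have e2 : ‖Complex.exp (Complex.I * y * (x - t))‖ = 1 := by
          rw [Complex.norm_exp]; simp
        simp only [Function.uncurry, norm_mul, e1, e2, mul_one, Complex.norm_real, Real.norm_eq_abs]
        gcongr
        exact hb t
  have lim : ∀ x : ℝ, ∫ t in Ioi (0:ℝ), (b t : ℂ) * k (x - t) =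
      ∫ y : ℝ, (φ y : ℂ) * Complex.exp (Complex.I * y * x) * H (Complex.I * y) := by
    intro x
    have hkx : Integrable (fun t => k (x - t)) := hk.comp_sub_left x
    have t1 : Tendsto (fun δ : ℝ => ∫ t in Ioi (0:ℝ), (b t : ℂ) * Complex.exp (-δ * t) * k (x - t))
        (𝓝[>] 0) (𝓝 (∫ t in Ioi (0:ℝ), (b t : ℂ) * k (x - t))) := by
      refine tendsto_integral_filter_of_dominated_convergence (fun t => C * ‖k (x - t)‖) ?_ ?_ ?_ ?_
      · refine Eventually.of_forall fun δ => ?_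
        refine AEStronglyMeasurable.mul (Measurable.aestronglyMeasurable (by fun_prop)) ?_
        exact (Complex.continuous_ofReal.comp_aestronglyMeasurable hkx.1).restrict
      · filter_upwards [self_mem_nhdsWithin] with δ hδ
        filter_upwards [ae_restrict_mem measurableSet_Ioi] with t ht
        have e1 : ‖Complex.exp (-δ * t)‖ ≤ 1 := by
          rw [Complex.norm_exp]; simp
          exact (mul_pos hδ ht).le
        rw [norm_mul, norm_mul, Complex.norm_real, Complex.norm_real]
        gcongr
        calc ‖b t‖ * ‖Complex.exp (-δ * t)‖ ≤ C * 1 := by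
              gcongr
              · exact (abs_nonneg _).trans (hb t)
              · exact hb t
          _ = C := mul_one C
      · exact (hkx.norm.const_mul C).restrict
      · refine Eventually.of_forall fun t => ?_
        have : Continuous (fun δ : ℝ => (b t : ℂ) * Complex.exp (-δ * t) * k (x - t)) := by fun_prop
        have h2 := (this.tendsto 0).mono_left (nhdsWithin_le_nhds (s := Ioi (0:ℝ)))
        simpa using h2
    have t2 : Tendsto (fun δ : ℝ => ∫ y : ℝ, (φ y : ℂ) * Complex.exp (Complex.I * y * x) * H (δ + Complex.I * y))
        (𝓝[>] 0) (𝓝 (∫ y : ℝ, (φ y : ℂ) * Complex.exp (Complex.I * y * x) * H (Complex.I * y))) := by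
      have hc2 : ContinuousOn (fun p : ℝ × ℝ => H (p.1 + Complex.I * p.2)) (Icc 0 1 ×ˢ Icc (-R) R) := by
        refine hH.comp (by fun_prop) ?_
        rintro ⟨p, q⟩ hp
        simpa using hp.1.1
      obtain ⟨M, hM⟩ := (isCompact_Icc.prod isCompact_Icc).exists_bound_of_continuousOn hc2
      refine tendsto_integral_filter_of_dominated_convergence (fun y => ‖φ y‖ * M) ?_ ?_ ?_ ?_
      · filter_upwards [self_mem_nhdsWithin] with δ hδ
        refine Continuous.aestronglyMeasurable ?_
        refine Continuous.mul (by fun_prop) ?_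
        rw [← continuousOn_univ]
        refine hH.comp (by fun_prop) ?_
        intro y _
        simpa using (le_of_lt hδ)
      · filter_upwards [Ioc_mem_nhdsGT (zero_lt_one (α := ℝ))] with δ hδ
        refine Eventually.of_forall fun y => ?_
        have e2 : ‖Complex.exp (Complex.I * y * x)‖ = 1 := by
          rw [Complex.norm_exp]; simp
        rw [norm_mul, norm_mul, e2, mul_one, Complex.norm_real]
        by_cases hy : R < |y|
        · simp [hR y hy]
        · gcongr
          exact hM (δ, y) ⟨⟨hδ.1.le, hδ.2⟩, abs_le.1 (not_lt.1 hy)⟩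
      · exact hφi.norm.mul_const M
      · refine Eventually.of_forall fun y => ?_
        refine Tendsto.const_mul _ ?_
        have h1 : ContinuousWithinAt H {s | 0 ≤ s.re} (Complex.I * y) := hH _ (by simp)
        have h2 : Tendsto (fun δ : ℝ => (δ : ℂ) + Complex.I * y) (𝓝[>] 0) (𝓝[{s | 0 ≤ s.re}] (Complex.I * y)) := by
          refine tendsto_nhdsWithin_iff.2 ⟨?_, ?_⟩
          · have : Continuous (fun δ : ℝ => (δ : ℂ) + Complex.I * y) := by fun_prop
            simpa using (this.tendsto 0).mono_left (nhdsWithin_le_nhds (s := Ioi (0:ℝ)))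
          · filter_upwards [self_mem_nhdsWithin] with δ hδ
            simpa using (le_of_lt hδ)
        exact h1.tendsto.comp h2
    refine tendsto_nhds_unique t1 (t2.congr' ?_)
    filter_upwards [self_mem_nhdsWithin] with δ hδ
    exact (key δ hδ x).symm
  have RL := Real.tendsto_integral_exp_smul_cocompact (fun y : ℝ => (φ y : ℂ) * H (Complex.I * y))
  have hto : Tendsto (fun x : ℝ => -x / (2 * Real.pi)) atTop (cocompact ℝ) := by
    refine Tendsto.mono_right ?_ atBot_le_cocompact
    exact (tendsto_neg_atTop_atBot).atBot_div_const (by positivity)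
  have RL2 := RL.comp hto
  have fin : Tendsto (fun x : ℝ => ((∫ t in Ioi (0:ℝ), b t * k (x - t) : ℝ) : ℂ)) atTop (𝓝 0) := by
    refine RL2.congr fun x => ?_
    rw [← integral_complex_ofReal]
    push_cast
    rw [lim x]
    refine integral_congr_ae (Eventually.of_forall fun y => ?_)
    simp only [Circle.smul_def, Real.fourierChar_apply, smul_eq_mul]
    have : Complex.exp (↑(2 * Real.pi * -(y * (-x / (2 * Real.pi)))) * Complex.I) = Complex.exp (Complex.I * y * x) := by
      congr 1
      have : 2 * Real.pi * -(y * (-x / (2 * Real.pi))) = y * x := by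
        field_simp
      rw [this]; push_cast; ring
    rw [this]; ring
  have := (Complex.continuous_re.tendsto _).comp fin
  simpa [Function.comp_def] using this

open MeasureTheory Topology Set in
theorem aux_fejer_integral (x : ℝ) :
    ∫ y : ℝ, ((max 0 (1 - |y|) : ℝ) : ℂ) * Complex.exp (Complex.I * y * x) = ((Real.sinc (x/2))^2 : ℝ) := by
  have h0 : ∫ y : ℝ, ((max 0 (1 - |y|) : ℝ) : ℂ) * Complex.exp (Complex.I * y * x) =
      ∫ y in (-1:ℝ)..1, ((max 0 (1 - |y|) : ℝ) : ℂ) * Complex.exp (Complex.I * y * x) := by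
    rw [intervalIntegral.integral_of_le (by norm_num), setIntegral_eq_integral_of_forall_compl_eq_zero]
    intro y hy
    have : max 0 (1 - |y|) = 0 := by
      apply max_eq_left
      by_contra h
      apply hy
      have := abs_lt.1 (show |y| < 1 by linarith)
      exact ⟨this.1, this.2.le⟩
    simp [this]
  have hii : ∀ a b : ℝ, IntervalIntegrable (fun y : ℝ => ((max 0 (1 - |y|) : ℝ) : ℂ) * Complex.exp (Complex.I * y * x)) volume a b := by
    intro a b
    apply Continuous.intervalIntegrable
    fun_prop
  have h1 : ∫ y in (-1:ℝ)..0, ((max 0 (1 - |y|) : ℝ) : ℂ) * Complex.exp (Complex.I * y * x) =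
      ∫ y in (0:ℝ)..1, ((max 0 (1 - |y|) : ℝ) : ℂ) * Complex.exp (-(Complex.I * y * x)) := by
    have := intervalIntegral.integral_comp_neg (a := (0:ℝ)) (b := 1) (fun y : ℝ => ((max 0 (1 - |y|) : ℝ) : ℂ) * Complex.exp (Complex.I * y * x))
    simp at this
    rw [← this]
  have hii2 : ∀ a b : ℝ, IntervalIntegrable (fun y : ℝ => ((max 0 (1 - |y|) : ℝ) : ℂ) * Complex.exp (-(Complex.I * y * x))) volume a b := by
    intro a b
    apply Continuous.intervalIntegrable
    fun_prop
  rw [h0, ← intervalIntegral.integral_add_adjacent_intervals (hii (-1) 0) (hii 0 1), h1,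
    ← intervalIntegral.integral_add (hii2 0 1) (hii 0 1)]
  have h2 : ∫ y in (0:ℝ)..1, (((max 0 (1 - |y|) : ℝ) : ℂ) * Complex.exp (-(Complex.I * y * x)) + ((max 0 (1 - |y|) : ℝ) : ℂ) * Complex.exp (Complex.I * y * x)) =
      ∫ y in (0:ℝ)..1, ((2 * (1 - y) * Real.cos (y * x) : ℝ) : ℂ) := by
    refine intervalIntegral.integral_congr ?_
    intro y hy
    rw [uIcc_of_le (by norm_num)] at hy
    simp only
    rw [abs_of_nonneg hy.1, max_eq_right (by linarith [hy.2])]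
    push_cast
    rw [show (2:ℂ) * (1 - y) * Complex.cos (y * x) = (1 - y) * (2 * Complex.cos (y * x)) by ring, Complex.two_cos]
    rw [show (y * x * Complex.I : ℂ) = Complex.I * y * x by ring, show (-(y * x) * Complex.I : ℂ) = -(Complex.I * y * x) by ring]
    ring
  rw [h2, intervalIntegral.integral_ofReal]
  congr 1
  rcases eq_or_ne x 0 with rfl | hx
  · have : ∀ y : ℝ, HasDerivAt (fun y : ℝ => 2 * y - y^2) (2 * (1 - y) * Real.cos (y * 0)) y := by
      intro y
      have := ((hasDerivAt_id y).const_mul 2).sub ((hasDerivAt_id y).pow 2)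
      refine this.congr_deriv ?_
      simp; ring
    rw [intervalIntegral.integral_eq_sub_of_hasDerivAt (fun y _ => this y)]
    · norm_num
    · apply Continuous.intervalIntegrable; fun_prop
  · have : ∀ y : ℝ, HasDerivAt (fun y : ℝ => 2 * ((1 - y) * Real.sin (y * x) / x - Real.cos (y * x) / x^2)) (2 * (1 - y) * Real.cos (y * x)) y := by
      intro y
      have l : HasDerivAt (fun y : ℝ => y * x) x y := by simpa using (hasDerivAt_id y).mul_const x
      have hs := l.sin
      have hc := l.cos
      have h1 : HasDerivAt (fun y : ℝ => 1 - y) (-1) y := by simpa using (hasDerivAt_id y).const_sub 1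
      have := ((((h1.mul hs).div_const x).sub (hc.div_const (x^2))).const_mul 2)
      refine this.congr_deriv ?_
      field_simp
      ring
    rw [intervalIntegral.integral_eq_sub_of_hasDerivAt (fun y _ => this y)]
    · rw [Real.sinc_of_ne_zero (by positivity)]
      have hc : Real.cos x = 1 - 2 * Real.sin (x/2)^2 := by
        have := Real.cos_two_mul (x/2)
        rw [show 2 * (x/2) = x by ring] at this
        have h3 := Real.sin_sq_add_cos_sq (x/2)
        linarith
      simp [hc]
      field_simp
      ring
    · apply Continuous.intervalIntegrable; fun_prop

open MeasureTheory Topology Set in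
theorem aux_fejer_integrable : Integrable (fun x : ℝ => (Real.sinc (x/2))^2) := by
  refine (integrable_inv_one_add_sq.const_mul 5).mono' ?_ (Eventually.of_forall fun x => ?_)
  · have := Real.continuous_sinc
    apply Continuous.aestronglyMeasurable
    fun_prop
  · rw [Real.norm_eq_abs, abs_of_nonneg (sq_nonneg _), ← div_eq_mul_inv, le_div_iff₀ (by positivity)]
    have h1 : Real.sinc (x/2)^2 ≤ 1 := by
      have := Real.abs_sinc_le_one (x/2)
      rw [← sq_abs]; exact pow_le_one₀ (abs_nonneg _) this
    have h2 : Real.sinc (x/2)^2 * x^2 ≤ 4 := by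
      rcases eq_or_ne x 0 with rfl | hx
      · norm_num
      · rw [Real.sinc_of_ne_zero (by positivity)]
        have := Real.sin_sq_le_one (x/2)
        field_simp
        linarith
    linarith

open MeasureTheory Topology Set in
theorem aux_fejer_pos : 0 < ∫ x : ℝ, (Real.sinc (x/2))^2 := by
  have hc : Continuous (fun x : ℝ => (Real.sinc (x/2))^2) := by
    have := Real.continuous_sinc
    fun_prop
  exact integral_pos_of_integrable_nonneg_nonzero (x := 0) hc aux_fejer_integrable
    (fun x => sq_nonneg _) (by simp)

open MeasureTheory Topology Set in
theorem aux_tauber (B : ℝ → ℝ) (hBm : Measurable B) (C : ℝ) (hB0 : ∀ t, 0 ≤ B t) (hBC : ∀ t, B t ≤ C)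
    (hmono : ∀ s t, s ≤ t → B s ≤ Real.exp (t - s) * B t)
    (hker : ∀ δ : ℝ, 0 < δ → ∃ k : ℝ → ℝ, (∀ u, 0 ≤ k u) ∧ Integrable k ∧ ∫ u, k u = 1 ∧
      1 - δ ≤ ∫ u in Icc (-δ) δ, k u ∧ Tendsto (fun x => ∫ u, B (x - u) * k u) atTop (𝓝 1)) :
    Tendsto B atTop (𝓝 1) := by
  have hC : 0 ≤ C := (hB0 0).trans (hBC 0)
  rw [Metric.tendsto_nhds]
  intro η hη
  have hd1 : Tendsto (fun δ : ℝ => Real.exp (-(2*δ)) * (1 - δ - C * δ)) (𝓝[>] 0) (𝓝 1) := by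
    have : Continuous (fun δ : ℝ => Real.exp (-(2*δ)) * (1 - δ - C * δ)) := by fun_prop
    simpa using (this.tendsto 0).mono_left (nhdsWithin_le_nhds (s := Ioi (0:ℝ)))
  have hd2 : Tendsto (fun δ : ℝ => Real.exp (-(2*δ)) * (1 - δ) * (1 + η) - (1 + δ)) (𝓝[>] 0) (𝓝 η) := by
    have : Continuous (fun δ : ℝ => Real.exp (-(2*δ)) * (1 - δ) * (1 + η) - (1 + δ)) := by fun_prop
    simpa using (this.tendsto 0).mono_left (nhdsWithin_le_nhds (s := Ioi (0:ℝ)))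
  obtain ⟨δ, ⟨h1, h2⟩, h3, h4⟩ := ((hd1.eventually (lt_mem_nhds (show 1 - η < 1 by linarith))).and
    (hd2.eventually (lt_mem_nhds hη)) |>.and (Ioo_mem_nhdsGT (zero_lt_one (α := ℝ)))).exists
  obtain ⟨k, hk0, hki, hk1, hkδ, hF⟩ := hker δ h3
  have hFe : ∀ᶠ x in atTop, 1 - δ < ∫ u, B (x - u) * k u :=
    hF.eventually (lt_mem_nhds (by linarith))
  have hFe' : ∀ᶠ x in atTop, ∫ u, B (x - u) * k u < 1 + δ :=
    hF.eventually (gt_mem_nhds (by linarith))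
  have hIntg : ∀ x, Integrable (fun u => B (x - u) * k u) := by
    intro x
    refine hki.bdd_mul (c := C) (Measurable.aestronglyMeasurable (by fun_prop)) (Eventually.of_forall fun u => ?_)
    rw [Real.norm_eq_abs, abs_of_nonneg (hB0 _)]; exact hBC _
  have hup : ∀ x, Real.exp (-(2*δ)) * B x * (1 - δ) ≤ ∫ u, B (x + δ - u) * k u := by
    intro x
    calc Real.exp (-(2*δ)) * B x * (1 - δ) ≤ Real.exp (-(2*δ)) * B x * ∫ u in Icc (-δ) δ, k u := by
          have := hB0 x
          gcongr
      _ = ∫ u in Icc (-δ) δ, Real.exp (-(2*δ)) * B x * k u := by rw [integral_const_mul]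
      _ ≤ ∫ u in Icc (-δ) δ, B (x + δ - u) * k u := by
          refine setIntegral_mono_on (hki.const_mul _).integrableOn (hIntg _).integrableOn measurableSet_Icc ?_
          intro u hu
          refine mul_le_mul_of_nonneg_right ?_ (hk0 u)
          have := hmono x (x + δ - u) (by linarith [hu.2])
          have h5 : B x ≤ Real.exp (2*δ) * B (x + δ - u) := by
            refine this.trans ?_
            refine mul_le_mul_of_nonneg_right ?_ (hB0 _)
            apply Real.exp_le_exp.2; linarith [hu.1]
          rw [Real.exp_neg]
          rw [inv_mul_le_iff₀ (Real.exp_pos _)]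
          exact h5
      _ ≤ ∫ u, B (x + δ - u) * k u :=
          setIntegral_le_integral (hIntg _) (Eventually.of_forall fun u => mul_nonneg (hB0 _) (hk0 _))
  have hlo : ∀ x, ∫ u, B (x - δ - u) * k u ≤ Real.exp (2*δ) * B x + C * δ := by
    intro x
    have hc : ∫ u in (Icc (-δ) δ)ᶜ, k u ≤ δ := by
      have := integral_add_compl (measurableSet_Icc (a := -δ) (b := δ)) hki
      linarith
    have hle1 : ∫ u in (Icc (-δ) δ), k u ≤ 1 := by
      rw [← hk1]
      exact setIntegral_le_integral hki (Eventually.of_forall hk0)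
    rw [← integral_add_compl (measurableSet_Icc (a := -δ) (b := δ)) (hIntg _)]
    refine add_le_add ?_ ?_
    · calc ∫ u in Icc (-δ) δ, B (x - δ - u) * k u ≤ ∫ u in Icc (-δ) δ, (Real.exp (2*δ) * B x) * k u := by
            refine setIntegral_mono_on (hIntg _).integrableOn (hki.const_mul _).integrableOn measurableSet_Icc ?_
            intro u hu
            refine mul_le_mul_of_nonneg_right ?_ (hk0 u)
            refine (hmono (x - δ - u) x (by linarith [hu.1])).trans ?_
            refine mul_le_mul_of_nonneg_right ?_ (hB0 _)
            apply Real.exp_le_exp.2; linarith [hu.2]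
        _ = (Real.exp (2*δ) * B x) * ∫ u in Icc (-δ) δ, k u := by rw [integral_const_mul]
        _ ≤ (Real.exp (2*δ) * B x) * 1 := by
            have := hB0 x
            gcongr
        _ = _ := mul_one _
    · calc ∫ u in (Icc (-δ) δ)ᶜ, B (x - δ - u) * k u ≤ ∫ u in (Icc (-δ) δ)ᶜ, C * k u := by
            refine setIntegral_mono (hIntg _).integrableOn (hki.const_mul _).integrableOn ?_
            intro u
            exact mul_le_mul_of_nonneg_right (hBC _) (hk0 u)
        _ = C * ∫ u in (Icc (-δ) δ)ᶜ, k u := by rw [integral_const_mul]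
        _ ≤ C * δ := by gcongr
  have e1 := (tendsto_atTop_add_const_right atTop δ tendsto_id).eventually hFe'
  have e2 := (tendsto_atTop_add_const_right atTop (-δ) tendsto_id).eventually hFe
  filter_upwards [e1, e2] with x a1 a2
  simp only [id] at a1 a2
  rw [← sub_eq_add_neg] at a2
  have b1 := hup x
  have b2 := hlo x
  rw [Real.dist_eq, abs_lt]
  have hep : 0 < Real.exp (-(2*δ)) := Real.exp_pos _
  constructor
  · have : Real.exp (-(2*δ)) * (1 - δ - C * δ) < Real.exp (-(2*δ)) * (Real.exp (2*δ) * B x) := by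
      apply mul_lt_mul_of_pos_left _ hep; linarith
    rw [← mul_assoc, ← Real.exp_add] at this
    simp at this
    linarith
  · have h6 : Real.exp (-(2*δ)) * (1 - δ) * B x < Real.exp (-(2*δ)) * (1 - δ) * (1 + η) := by linarith
    have := lt_of_mul_lt_mul_left h6 (mul_pos hep (by linarith)).le
    linarith

open MeasureTheory Topology Set in
theorem aux_kernel (B : ℝ → ℝ) (hBm : Measurable B) (C : ℝ) (hB0 : ∀ t, 0 ≤ B t) (hBC : ∀ t, B t ≤ C)
    (hBneg : ∀ t, t ≤ 0 → B t = 0)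
    (H : ℂ → ℂ) (hH : ContinuousOn H {s | 0 ≤ s.re})
    (hL : ∀ s : ℂ, 0 < s.re → ∫ t in Ioi (0:ℝ), ((B t - 1 : ℝ) : ℂ) * Complex.exp (-s * t) = H s)
    (δ : ℝ) (hδ : 0 < δ) : ∃ k : ℝ → ℝ, (∀ u, 0 ≤ k u) ∧ Integrable k ∧ ∫ u, k u = 1 ∧
      1 - δ ≤ ∫ u in Icc (-δ) δ, k u ∧ Tendsto (fun x => ∫ u, B (x - u) * k u) atTop (𝓝 1) := by
  obtain ⟨c, hc⟩ : ∃ c, c = ∫ x : ℝ, (Real.sinc (x/2))^2 := ⟨_, rfl⟩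
  have hc0 : 0 < c := hc ▸ aux_fejer_pos
  have hC : 0 ≤ C := (hB0 0).trans (hBC 0)
  have hlim : Tendsto (fun l : ℝ => ∫ x in (l * (-δ))..(l * δ), (Real.sinc (x/2))^2) atTop (𝓝 c) := by
    rw [hc]
    refine intervalIntegral_tendsto_integral aux_fejer_integrable ?_ ?_
    · exact tendsto_id.atTop_mul_const_of_neg (by linarith)
    · exact tendsto_id.atTop_mul_const hδ
  obtain ⟨l, hl, hl0⟩ := ((hlim.eventually (lt_mem_nhds (show (1 - δ) * c < c by nlinarith))).and
    (eventually_gt_atTop 0)).exists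
  obtain ⟨k, hkdef⟩ : ∃ k : ℝ → ℝ, k = fun u => (l / c) * (Real.sinc (l * u / 2))^2 := ⟨_, rfl⟩
  have hk0 : ∀ u, 0 ≤ k u := by intro u; rw [hkdef]; positivity
  have hki : Integrable k := by
    rw [hkdef]
    exact (aux_fejer_integrable.comp_mul_left' hl0.ne').const_mul _
  have hk1 : ∫ u, k u = 1 := by
    rw [hkdef, integral_const_mul]
    have := Measure.integral_comp_mul_left (fun x : ℝ => (Real.sinc (x/2))^2) l
    rw [this, ← hc, abs_of_pos (by positivity), smul_eq_mul]
    field_simp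
  refine ⟨k, hk0, hki, hk1, ?_, ?_⟩
  · rw [integral_Icc_eq_integral_Ioc, ← intervalIntegral.integral_of_le (by linarith), hkdef,
      intervalIntegral.integral_const_mul]
    have := intervalIntegral.integral_comp_mul_left (a := -δ) (b := δ) (fun x : ℝ => (Real.sinc (x/2))^2) hl0.ne'
    rw [this, smul_eq_mul]
    rw [show ∀ J : ℝ, l / c * (l⁻¹ * J) = J / c by intro J; field_simp]
    rw [le_div_iff₀ hc0]
    exact hl.le
  · have hw := aux_wiener (fun t => B t - 1) (by fun_prop) (C + 1) (by
        intro t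
        rw [abs_le]; constructor <;> linarith [hB0 t, hBC t]) H hH hL
        (fun y => (1 / c) * max 0 (1 - |l⁻¹ * y|)) (by fun_prop) l (by
        intro y hy
        have : 1 ≤ |l⁻¹ * y| := by
          rw [abs_mul, abs_of_pos (inv_pos.2 hl0), ← div_eq_inv_mul, le_div_iff₀ hl0]
          linarith
        rw [max_eq_left (by linarith), mul_zero]) k hki (by
        intro x
        have := Measure.integral_comp_mul_left (fun y : ℝ => ((max 0 (1 - |y|) : ℝ) : ℂ) * Complex.exp (Complex.I * y * (l * x : ℝ))) l⁻¹
        rw [aux_fejer_integral, inv_inv, abs_of_pos hl0] at this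
        have h2 : ((k x : ℝ) : ℂ) = (1 / c : ℂ) * (l • (((Real.sinc (l * x / 2))^2 : ℝ) : ℂ)) := by
          rw [hkdef, Complex.real_smul]; push_cast; ring
        rw [h2, ← this, ← integral_const_mul]
        refine integral_congr_ae (Eventually.of_forall fun y => ?_)
        simp only
        have h3 : Complex.I * ((l⁻¹ * y : ℝ) : ℂ) * ((l * x : ℝ) : ℂ) = Complex.I * y * x := by
          have : (l : ℂ) ≠ 0 := by exact_mod_cast hl0.ne'
          push_cast
          field_simp
        rw [h3]
        push_cast
        ring)
    have hone : Tendsto (fun x : ℝ => ∫ t in Ioi (0:ℝ), k (x - t)) atTop (𝓝 1) := by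
      have h1 : Tendsto (fun x : ℝ => ∫ u, (Iio x).indicator k u) atTop (𝓝 (∫ u, k u)) := by
        refine tendsto_integral_filter_of_dominated_convergence (fun u => ‖k u‖) ?_ ?_ hki.norm ?_
        · exact Eventually.of_forall fun x => (hki.indicator measurableSet_Iio).1
        · exact Eventually.of_forall fun x => Eventually.of_forall fun u => norm_indicator_le_norm_self _ _
        · refine Eventually.of_forall fun u => ?_
          refine tendsto_const_nhds.congr' ?_
          filter_upwards [eventually_gt_atTop u] with x hx
          rw [indicator_of_mem]; exact hx
      rw [hk1] at h1
      refine h1.congr fun x => ?_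
      rw [← integral_indicator measurableSet_Ioi, ← integral_sub_left_eq_self _ volume x]
      congr 1
      ext t
      simp [indicator]
    have hsum := hw.add hone
    rw [zero_add] at hsum
    refine hsum.congr fun x => ?_
    have hkx : Integrable (fun t => k (x - t)) := hki.comp_sub_left x
    have hbk : Integrable (fun t => B t * k (x - t)) := by
      refine hkx.bdd_mul (c := C) (Measurable.aestronglyMeasurable (by fun_prop)) (Eventually.of_forall fun u => ?_)
      rw [Real.norm_eq_abs, abs_of_nonneg (hB0 _)]; exact hBC _
    have h5 : ∀ t, (B t - 1) * k (x - t) = B t * k (x - t) - k (x - t) := by intro t; ring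
    simp_rw [h5]
    rw [integral_sub hbk.integrableOn hkx.integrableOn, sub_add_cancel]
    rw [setIntegral_eq_integral_of_forall_compl_eq_zero]
    · rw [← integral_sub_left_eq_self _ volume x]
      simp
    · intro t ht
      rw [hBneg t (not_lt.1 ht), zero_mul]

open MeasureTheory Topology Set in
theorem aux_laplace (s : ℂ) (hs : 0 < s.re) :
    ∫ t in Ioi (0:ℝ), ((Chebyshev.psi (Real.exp t) * Real.exp (-t) - 1 : ℝ) : ℂ) * Complex.exp (-s * t) =
      (ArithmeticFunction.vonMangoldt.LFunctionResidueClassAux (1 : ZMod 1) (s + 1) - 1) / (s + 1) := by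
  have hpm : Measurable Chebyshev.psi := Chebyshev.psi_mono.measurable
  have hs1 : 1 < (s + 1).re := by simpa using hs
  have hs0 : s ≠ 0 := by rintro rfl; simp at hs
  have hs10 : s + 1 ≠ 0 := by intro h; rw [h] at hs1; simp at hs1; linarith
  have hpsi : ∀ x : ℝ, ∑ k ∈ Finset.Icc 1 ⌊x⌋₊, (ArithmeticFunction.vonMangoldt k) = Chebyshev.psi x := by
    intro x; rfl
  have hA := ArithmeticFunction.vonMangoldt.eqOn_LFunctionResidueClassAux (a := (1 : ZMod 1)) isUnit_one hs1
  have hres : ∀ n, ArithmeticFunction.vonMangoldt.residueClass (1 : ZMod 1) n = ArithmeticFunction.vonMangoldt n := by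
    intro n
    rw [ArithmeticFunction.vonMangoldt.residueClass, indicator_of_mem]
    exact Subsingleton.elim _ _
  simp only [hres] at hA
  have hI := LSeries_eq_mul_integral_of_nonneg (fun n => ArithmeticFunction.vonMangoldt n) (r := 1)
    zero_le_one hs1 (by
      refine Asymptotics.IsBigO.of_bound (Real.log 4 + 4) (Eventually.of_forall fun n => ?_)
      have h1 := hpsi n
      rw [Nat.floor_natCast] at h1
      rw [h1, Real.rpow_one, Real.norm_of_nonneg (Chebyshev.psi_nonneg _), Real.norm_of_nonneg (by positivity)]
      exact Chebyshev.psi_le_const_mul_self (by positivity))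
    (fun n => ArithmeticFunction.vonMangoldt_nonneg)
  simp_rw [← Complex.ofReal_sum, hpsi] at hI
  have himg : Set.image Real.exp (Ioi 0) = Ioi 1 := by
    ext y; constructor
    · rintro ⟨t, ht, rfl⟩; exact Real.one_lt_exp_iff.2 ht
    · intro hy; exact ⟨Real.log y, Real.log_pos hy, Real.exp_log (zero_lt_one.trans hy)⟩
  have hcv := integral_image_eq_integral_abs_deriv_smul (s := Ioi (0:ℝ)) (f := Real.exp) (f' := Real.exp) measurableSet_Ioi
    (fun x _ => (Real.hasDerivAt_exp x).hasDerivWithinAt) Real.exp_injective.injOn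
    (fun u : ℝ => (Chebyshev.psi u : ℂ) * (u : ℂ) ^ (-(s + 1 + 1)))
  rw [himg] at hcv
  rw [hcv] at hI
  have hfun : ∀ t : ℝ, |Real.exp t| • ((Chebyshev.psi (Real.exp t) : ℂ) * ((Real.exp t : ℝ) : ℂ) ^ (-(s + 1 + 1))) =
      ((Chebyshev.psi (Real.exp t) * Real.exp (-t) : ℝ) : ℂ) * Complex.exp (-s * t) := by
    intro t
    rw [abs_of_pos (Real.exp_pos t), Complex.real_smul]
    rw [Complex.cpow_def_of_ne_zero (by exact_mod_cast (Real.exp_pos t).ne'), ← Complex.ofReal_log (Real.exp_pos t).le, Real.log_exp]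
    push_cast
    have : Complex.exp t * Complex.exp (t * (-(s + 1 + 1))) = Complex.exp (-t) * Complex.exp (-s * t) := by
      rw [← Complex.exp_add, ← Complex.exp_add]; congr 1; ring
    linear_combination (Chebyshev.psi (Real.exp t) : ℂ) * this
  simp_rw [hfun] at hI
  have hexp : IntegrableOn (fun t : ℝ => Complex.exp (-s * t)) (Ioi 0) :=
    integrableOn_exp_mul_complex_Ioi (by simpa using hs) 0
  have hexpI := integral_exp_mul_complex_Ioi (a := -s) (by simpa using hs) 0
  have hIntg : IntegrableOn (fun t : ℝ => ((Chebyshev.psi (Real.exp t) * Real.exp (-t) : ℝ) : ℂ) * Complex.exp (-s * t)) (Ioi 0) := by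
    refine Integrable.bdd_mul (c := Real.log 4 + 4) hexp (Measurable.aestronglyMeasurable (by fun_prop)) (Eventually.of_forall fun t => ?_)
    rw [Complex.norm_real, Real.norm_of_nonneg (mul_nonneg (Chebyshev.psi_nonneg _) (Real.exp_pos _).le)]
    rw [Real.exp_neg, ← div_eq_mul_inv, div_le_iff₀ (Real.exp_pos _)]
    exact Chebyshev.psi_le_const_mul_self (Real.exp_pos _).le
  have hsplit : ∀ t : ℝ, ((Chebyshev.psi (Real.exp t) * Real.exp (-t) - 1 : ℝ) : ℂ) * Complex.exp (-s * t) =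
    ((Chebyshev.psi (Real.exp t) * Real.exp (-t) : ℝ) : ℂ) * Complex.exp (-s * t) - Complex.exp (-s * t) := by
    intro t; push_cast; ring
  simp_rw [hsplit]
  rw [integral_sub hIntg hexp, hexpI, hA, hI]
  simp
  field_simp
  ring

open MeasureTheory Topology Set in
theorem aux_pnt_psi : Tendsto (fun x : ℝ => Chebyshev.psi x / x) atTop (𝓝 1) := by
  have hpm : Measurable Chebyshev.psi := Chebyshev.psi_mono.measurable
  have hB0 : ∀ t : ℝ, 0 ≤ Chebyshev.psi (Real.exp t) * Real.exp (-t) := fun t =>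
    mul_nonneg (Chebyshev.psi_nonneg _) (Real.exp_pos _).le
  have hBC : ∀ t : ℝ, Chebyshev.psi (Real.exp t) * Real.exp (-t) ≤ Real.log 4 + 4 := by
    intro t
    rw [Real.exp_neg, ← div_eq_mul_inv, div_le_iff₀ (Real.exp_pos _)]
    exact Chebyshev.psi_le_const_mul_self (Real.exp_pos _).le
  have hBm : Measurable (fun t : ℝ => Chebyshev.psi (Real.exp t) * Real.exp (-t)) := by fun_prop
  have main := aux_tauber (fun t : ℝ => Chebyshev.psi (Real.exp t) * Real.exp (-t)) hBm (Real.log 4 + 4) hB0 hBC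
    (by
      intro s t hst
      have h1 : Chebyshev.psi (Real.exp s) ≤ Chebyshev.psi (Real.exp t) := Chebyshev.psi_mono (Real.exp_le_exp.2 hst)
      have h2 : Real.exp (t - s) * (Chebyshev.psi (Real.exp t) * Real.exp (-t)) = Chebyshev.psi (Real.exp t) * Real.exp (-s) := by
        rw [show -s = (t - s) + -t by ring, Real.exp_add]; ring
      rw [h2]
      exact mul_le_mul_of_nonneg_right h1 (Real.exp_pos _).le)
    (aux_kernel _ hBm (Real.log 4 + 4) hB0 hBC
      (by
        intro t ht
        rw [Chebyshev.psi_eq_zero_of_le_one (Real.exp_le_one_iff.2 ht), zero_mul])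
      (fun s => (ArithmeticFunction.vonMangoldt.LFunctionResidueClassAux (1 : ZMod 1) (s + 1) - 1) / (s + 1))
      (by
        refine ContinuousOn.div ?_ (by fun_prop) ?_
        · refine ContinuousOn.sub ?_ continuousOn_const
          refine (ArithmeticFunction.vonMangoldt.continuousOn_LFunctionResidueClassAux (1 : ZMod 1)).comp (by fun_prop) ?_
          intro s hs
          simpa using hs
        · intro s hs h
          have := congrArg Complex.re h
          simp at this hs
          linarith)
      aux_laplace)
  have := main.comp Real.tendsto_log_atTop
  refine this.congr' ?_
  filter_upwards [eventually_gt_atTop 0] with x hx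
  simp only [Function.comp]
  rw [Real.exp_neg, Real.exp_log hx, div_eq_mul_inv]

open Topology in
theorem aux_pnt_pi : Tendsto (fun x : ℝ => (Nat.primeCounting ⌊x⌋₊ : ℝ) * Real.log x / x) atTop (𝓝 1) := by
  have hθ : Tendsto (fun x : ℝ => Chebyshev.theta x / x) atTop (𝓝 1) := by
    obtain ⟨C, hC⟩ := Chebyshev.psi_sub_theta_le_mul_sqrt
    have h1 : Tendsto (fun x : ℝ => C * (√x)⁻¹) atTop (𝓝 0) := by
      simpa using (Real.tendsto_sqrt_atTop.inv_tendsto_atTop).const_mul C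
    have h2 : Tendsto (fun x : ℝ => (Chebyshev.psi x - Chebyshev.theta x) / x) atTop (𝓝 0) := by
      refine squeeze_zero' ?_ ?_ h1
      · filter_upwards [eventually_gt_atTop 0] with x hx
        exact div_nonneg (sub_nonneg.2 (Chebyshev.theta_le_psi x)) hx.le
      · filter_upwards [eventually_gt_atTop 0] with x hx
        rw [div_le_iff₀ hx]
        refine (hC x).trans (le_of_eq ?_)
        have h3 : √x ≠ 0 := (Real.sqrt_pos.2 hx).ne'
        have h4 : (√x)⁻¹ * x = √x := by
          rw [inv_mul_eq_iff_eq_mul₀ h3, Real.mul_self_sqrt hx.le]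
        rw [mul_assoc, h4]
    have := aux_pnt_psi.sub h2
    rw [sub_zero] at this
    refine this.congr fun x => ?_
    ring
  have h1 : Tendsto (fun x : ℝ => ((Nat.primeCounting ⌊x⌋₊ : ℝ) - Chebyshev.theta x / Real.log x) * (Real.log x / x)) atTop (𝓝 0) := by
    have hO := Chebyshev.primeCounting_sub_theta_div_log_isBigO.mul
      (Asymptotics.isBigO_refl (fun x : ℝ => Real.log x / x) atTop)
    refine hO.trans_tendsto ?_
    refine (Real.tendsto_log_atTop.inv_tendsto_atTop).congr' ?_
    filter_upwards [eventually_gt_atTop 1] with x hx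
    have := Real.log_pos hx
    simp only [Pi.inv_apply]
    field_simp
  have := h1.add hθ
  rw [zero_add] at this
  refine this.congr' ?_
  filter_upwards [eventually_gt_atTop 1] with x hx
  have := Real.log_pos hx
  field_simp
  ring

open MeasureTheory Set in
theorem aux_tail_integral (Y : ℝ) (hY : 1 ≤ Y) :
    ∑' p : Nat.Primes, (if Y < ((p : ℕ) : ℝ) then ((p : ℕ) : ℝ) ^ (-(13:ℝ)/9) else 0) =
      (13/9 : ℝ) * ∫ t in Ioi (1:ℝ), ((Nat.primeCounting ⌊t⌋₊ - Nat.primeCounting ⌊Y⌋₊ : ℕ) : ℝ) * t ^ (-(22:ℝ)/9) := by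
  obtain ⟨f, hf⟩ : ∃ f : ℕ → ℝ, f = fun n : ℕ => if n.Prime ∧ Y < (n:ℝ) then (1:ℝ) else 0 := ⟨_, rfl⟩
  have hf0 : ∀ n, 0 ≤ f n := by intro n; rw [hf]; dsimp only; split_ifs <;> norm_num
  have hf1 : ∀ n, f n ≤ 1 := by intro n; rw [hf]; dsimp only; split_ifs <;> norm_num
  have hI := LSeries_eq_mul_integral_of_nonneg f (r := 1) (s := ((13/9 : ℝ) : ℂ)) zero_le_one
    (by rw [Complex.ofReal_re]; norm_num) (by
      refine Asymptotics.IsBigO.of_bound 1 (Eventually.of_forall fun n => ?_)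
      rw [Real.rpow_one, Real.norm_of_nonneg (Finset.sum_nonneg fun i _ => hf0 i), Real.norm_of_nonneg (by positivity), one_mul]
      calc ∑ k ∈ Finset.Icc 1 n, f k ≤ ∑ k ∈ Finset.Icc 1 n, (1:ℝ) := Finset.sum_le_sum fun i _ => hf1 i
        _ = n := by simp) hf0
  have hsum : ∀ t : ℝ, ∑ k ∈ Finset.Icc 1 ⌊t⌋₊, f k = ((Nat.primeCounting ⌊t⌋₊ - Nat.primeCounting ⌊Y⌋₊ : ℕ) : ℝ) := by
    intro t
    rw [hf, Finset.sum_boole]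
    congr 1
    rw [← Nat.primesLE_card_eq_primeCounting, ← Nat.primesLE_card_eq_primeCounting]
    rcases le_total ⌊Y⌋₊ ⌊t⌋₊ with h | h
    · rw [← Finset.card_sdiff_of_subset]
      · congr 1
        ext n
        simp only [Finset.mem_filter, Finset.mem_Icc, Finset.mem_sdiff, Nat.mem_primesLE]
        rw [← Nat.floor_lt (by linarith)]
        constructor
        · rintro ⟨⟨a, b⟩, c, d⟩; exact ⟨⟨b, c⟩, fun e => by omega⟩
        · rintro ⟨⟨a, b⟩, c⟩
          refine ⟨⟨b.one_lt.le, a⟩, b, ?_⟩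
          by_contra h; exact c ⟨by omega, b⟩
      · intro n; simp only [Nat.mem_primesLE]; rintro ⟨a, b⟩; exact ⟨a.trans h, b⟩
    · have h1 : (Nat.primesLE ⌊t⌋₊).card ≤ (Nat.primesLE ⌊Y⌋₊).card := by
        apply Finset.card_le_card
        intro n; simp only [Nat.mem_primesLE]; rintro ⟨a, b⟩; exact ⟨a.trans h, b⟩
      rw [Nat.sub_eq_zero_of_le h1, Finset.card_eq_zero, Finset.filter_eq_empty_iff]
      intro n hn ⟨_, hn2⟩
      rw [← Nat.floor_lt (by linarith)] at hn2
      have := (Finset.mem_Icc.1 hn).2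
      omega
  simp_rw [← Complex.ofReal_sum, hsum] at hI
  have hIntg : ∫ t in Ioi (1:ℝ), ((((Nat.primeCounting ⌊t⌋₊ - Nat.primeCounting ⌊Y⌋₊ : ℕ) : ℝ)) : ℂ) * (t:ℂ) ^ (-(((13/9 : ℝ) : ℂ) + 1)) =
      ((∫ t in Ioi (1:ℝ), ((Nat.primeCounting ⌊t⌋₊ - Nat.primeCounting ⌊Y⌋₊ : ℕ) : ℝ) * t ^ (-(22:ℝ)/9) : ℝ) : ℂ) := by
    rw [← integral_complex_ofReal]
    refine setIntegral_congr_fun measurableSet_Ioi ?_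
    intro t ht
    simp only
    rw [Complex.ofReal_mul, Complex.ofReal_cpow (zero_lt_one.trans ht).le]
    congr 2
    push_cast; norm_num
  rw [hIntg, ← Complex.ofReal_mul] at hI
  rw [← Complex.ofReal_inj, ← hI, LSeries]
  have hterm : ∀ n, LSeries.term (fun n => (f n : ℂ)) ((13/9 : ℝ) : ℂ) n = ((({p : ℕ | p.Prime}).indicator (fun n : ℕ => if Y < (n:ℝ) then (n:ℝ) ^ (-(13:ℝ)/9) else 0) n : ℝ) : ℂ) := by
    intro n
    rcases eq_or_ne n 0 with rfl | hn
    · rw [LSeries.term_zero, indicator_of_notMem]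
      · simp
      · simp [Nat.not_prime_zero]
    · rw [LSeries.term_of_ne_zero hn, ← Complex.ofReal_natCast, ← Complex.ofReal_cpow (by positivity), ← Complex.ofReal_div]
      congr 1
      rw [hf, indicator_apply]
      simp only [mem_setOf_eq]
      have : (n:ℝ) ^ (-(13:ℝ)/9) = 1 / (n:ℝ)^((13:ℝ)/9) := by
        rw [neg_div, Real.rpow_neg (by positivity), one_div]
      by_cases h1 : n.Prime <;> by_cases h2 : Y < (n:ℝ) <;> simp [h1, h2, this]
  simp_rw [hterm]
  rw [← Complex.ofReal_tsum]
  congr 1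
  exact tsum_subtype {p : ℕ | p.Prime} (fun n : ℕ => if Y < (n:ℝ) then (n:ℝ) ^ (-(13:ℝ)/9) else 0)

open MeasureTheory Set Topology in
theorem aux_tail_asymp : Tendsto (fun Y : ℝ => Y ^ ((4:ℝ)/9) * Real.log Y *
    ∑' p : Nat.Primes, (if Y < ((p : ℕ) : ℝ) then ((p : ℕ) : ℝ) ^ (-(13:ℝ)/9) else 0)) atTop (𝓝 (9/4)) := by
  have hlim : Tendsto (fun Y : ℝ => ∫ u in Ioi (1:ℝ),
      (((Nat.primeCounting ⌊Y * u⌋₊ - Nat.primeCounting ⌊Y⌋₊ : ℕ) : ℝ) * Real.log Y / Y) * u ^ (-(22:ℝ)/9)) atTop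
      (𝓝 (∫ u in Ioi (1:ℝ), (u - 1) * u ^ (-(22:ℝ)/9))) := by
    refine tendsto_integral_filter_of_dominated_convergence (fun u => 2 * u ^ (-(13:ℝ)/9)) ?_ ?_ ?_ ?_
    · refine Eventually.of_forall fun Y => Measurable.aestronglyMeasurable ?_
      have h1 : Measurable (fun u : ℝ => ((Nat.primeCounting ⌊Y * u⌋₊ - Nat.primeCounting ⌊Y⌋₊ : ℕ) : ℝ)) := by
        have : Measurable (fun n : ℕ => ((Nat.primeCounting n - Nat.primeCounting ⌊Y⌋₊ : ℕ) : ℝ)) := measurable_from_nat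
        exact this.comp (Nat.measurable_floor.comp (measurable_const.mul measurable_id))
      fun_prop
    · have := aux_pnt_pi.eventually (gt_mem_nhds (show (1:ℝ) < 2 by norm_num))
      obtain ⟨x0, hx0⟩ := eventually_atTop.1 this
      filter_upwards [eventually_ge_atTop x0, eventually_gt_atTop 1] with Y h1 h2
      filter_upwards [ae_restrict_mem measurableSet_Ioi] with u hu
      have hu1 : (1:ℝ) < u := hu
      have hlY := Real.log_pos h2
      have hYu : Y < Y * u := by nlinarith
      have hl : Real.log Y ≤ Real.log (Y * u) := Real.log_le_log (by linarith) hYu.le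
      have hb := hx0 (Y * u) (by linarith)
      have hup : 0 < u ^ (-(22:ℝ)/9) := Real.rpow_pos_of_pos (by linarith) _
      rw [norm_mul, Real.norm_of_nonneg (by positivity), Real.norm_of_nonneg hup.le]
      have hsplit : u ^ (-(13:ℝ)/9) = u * u ^ (-(22:ℝ)/9) := by
        rw [← Real.rpow_one_add' (by linarith) (by norm_num)]; norm_num
      rw [hsplit, ← mul_assoc]
      refine mul_le_mul_of_nonneg_right ?_ hup.le
      rw [div_lt_iff₀ (by linarith)] at hb
      rw [div_le_iff₀ (by linarith)]
      have h5 : ((Nat.primeCounting ⌊Y * u⌋₊ - Nat.primeCounting ⌊Y⌋₊ : ℕ) : ℝ) ≤ (Nat.primeCounting ⌊Y * u⌋₊ : ℝ) := by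
        exact_mod_cast Nat.sub_le _ _
      calc _ ≤ (Nat.primeCounting ⌊Y * u⌋₊ : ℝ) * Real.log (Y * u) := by gcongr
        _ ≤ 2 * (Y * u) := hb.le
        _ = 2 * u * Y := by ring
    · exact (integrableOn_Ioi_rpow_of_lt (by norm_num) one_pos).const_mul 2
    · filter_upwards [ae_restrict_mem measurableSet_Ioi] with u hu
      have hu1 : (1:ℝ) < u := hu
      refine Tendsto.mul_const _ ?_
      have a1 := aux_pnt_pi.comp (tendsto_id.atTop_mul_const (show (0:ℝ) < u by linarith))
      have a2 : Tendsto (fun Y : ℝ => Real.log Y / Real.log (Y * u)) atTop (𝓝 1) := by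
        have : Tendsto (fun Y : ℝ => 1 + Real.log u / Real.log Y) atTop (𝓝 1) := by
          simpa using (Real.tendsto_log_atTop.const_div_atTop (Real.log u)).const_add 1
        have h2 := this.inv₀ one_ne_zero
        rw [inv_one] at h2
        refine h2.congr' ?_
        filter_upwards [eventually_gt_atTop 1] with Y hY
        have hlY := Real.log_pos hY
        have := Real.log_pos hu1
        rw [Real.log_mul (by linarith) (by linarith)]
        field_simp
      have a3 := ((a1.mul a2).mul_const u).sub aux_pnt_pi
      rw [one_mul, one_mul] at a3
      refine a3.congr' ?_
      filter_upwards [eventually_gt_atTop 1] with Y hY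
      have hlY := Real.log_pos hY
      have hYu : Y < Y * u := by nlinarith
      have hl := Real.log_pos (hY.trans hYu)
      have hle : Nat.primeCounting ⌊Y⌋₊ ≤ Nat.primeCounting ⌊Y * u⌋₊ :=
        Nat.monotone_primeCounting (Nat.floor_mono hYu.le)
      rw [Nat.cast_sub hle]
      simp only [Function.comp, id]
      field_simp
  have hval : ∫ u in Ioi (1:ℝ), (u - 1) * u ^ (-(22:ℝ)/9) = 9/4 - 9/13 := by
    have : ∫ u in Ioi (1:ℝ), (u - 1) * u ^ (-(22:ℝ)/9) = ∫ u in Ioi (1:ℝ), (u ^ (-(13:ℝ)/9) - u ^ (-(22:ℝ)/9)) := by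
      refine setIntegral_congr_fun measurableSet_Ioi ?_
      intro u hu
      have hu1 : (1:ℝ) < u := hu
      have hsplit : u ^ (-(13:ℝ)/9) = u * u ^ (-(22:ℝ)/9) := by
        rw [← Real.rpow_one_add' (by linarith) (by norm_num)]; norm_num
      simp only [hsplit]; ring
    rw [this, integral_sub (integrableOn_Ioi_rpow_of_lt (by norm_num) one_pos) (integrableOn_Ioi_rpow_of_lt (by norm_num) one_pos),
      integral_Ioi_rpow_of_lt (by norm_num) one_pos, integral_Ioi_rpow_of_lt (by norm_num) one_pos]
    norm_num
  rw [hval] at hlim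
  have h2 := hlim.const_mul (13/9)
  rw [show (13/9 : ℝ) * (9/4 - 9/13) = 9/4 by norm_num] at h2
  refine h2.congr' ?_
  filter_upwards [eventually_gt_atTop 1] with Y hY
  rw [aux_tail_integral Y hY.le]
  have hY0 : 0 < Y := by linarith
  have e1 : ∫ t in Ioi (1:ℝ), ((Nat.primeCounting ⌊t⌋₊ - Nat.primeCounting ⌊Y⌋₊ : ℕ) : ℝ) * t ^ (-(22:ℝ)/9) =
      ∫ t in Ioi Y, ((Nat.primeCounting ⌊t⌋₊ - Nat.primeCounting ⌊Y⌋₊ : ℕ) : ℝ) * t ^ (-(22:ℝ)/9) := by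
    refine setIntegral_eq_of_subset_of_forall_sdiff_eq_zero measurableSet_Ioi (Ioi_subset_Ioi hY.le) ?_
    intro t ht
    have : t ≤ Y := not_lt.1 ht.2
    rw [Nat.sub_eq_zero_of_le (Nat.monotone_primeCounting (Nat.floor_mono this))]
    simp
  have e2 := integral_comp_mul_left_Ioi (fun t => ((Nat.primeCounting ⌊t⌋₊ - Nat.primeCounting ⌊Y⌋₊ : ℕ) : ℝ) * t ^ (-(22:ℝ)/9)) 1 hY0
  rw [mul_one, smul_eq_mul] at e2
  rw [e1, show ∫ t in Ioi Y, ((Nat.primeCounting ⌊t⌋₊ - Nat.primeCounting ⌊Y⌋₊ : ℕ) : ℝ) * t ^ (-(22:ℝ)/9) =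
    Y * ∫ u in Ioi (1:ℝ), ((Nat.primeCounting ⌊Y * u⌋₊ - Nat.primeCounting ⌊Y⌋₊ : ℕ) : ℝ) * (Y * u) ^ (-(22:ℝ)/9) by
      rw [e2]; field_simp]
  rw [show ∀ J : ℝ, Y ^ ((4:ℝ)/9) * Real.log Y * (13/9 * (Y * J)) = 13/9 * ((Y ^ ((4:ℝ)/9) * Real.log Y * Y) * J) by intro J; ring]
  congr 1
  rw [← integral_const_mul]
  refine setIntegral_congr_fun measurableSet_Ioi ?_
  intro u hu
  have hu1 : (1:ℝ) < u := hu
  simp only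
  rw [Real.mul_rpow hY0.le (by linarith)]
  have e3 : Y ^ ((4:ℝ)/9) * Y * Y ^ (-(22:ℝ)/9) = Y⁻¹ := by
    rw [← Real.rpow_add_one hY0.ne', ← Real.rpow_add hY0, ← Real.rpow_neg_one]; norm_num
  rw [div_eq_mul_inv, ← e3]
  ring

open Topology in
theorem aux_prod_bounds {ι : Type*} (d : ι → ℝ) (h0 : ∀ i, 0 ≤ d i) (h1 : ∀ i, d i ≤ 1) (hs : Summable d) :
    1 - ∏' i, (1 - d i) ≤ ∑' i, d i ∧ (∑' i, d i) / (1 + ∑' i, d i) ≤ 1 - ∏' i, (1 - d i) := by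
  have hm : Multipliable (fun i => 1 - d i) := by
    have := multipliable_one_add_of_summable (f := fun i => - d i) (by simpa [abs_of_nonneg (h0 _)] using hs)
    simpa [sub_eq_add_neg] using this
  have hp : Tendsto (fun s : Finset ι => ∏ i ∈ s, (1 - d i)) atTop (𝓝 (∏' i, (1 - d i))) := hm.hasProd
  have hd : Tendsto (fun s : Finset ι => ∑ i ∈ s, d i) atTop (𝓝 (∑' i, d i)) := hs.hasSum
  have hD : 0 ≤ ∑' i, d i := tsum_nonneg h0
  constructor
  · have : 1 - ∑' i, d i ≤ ∏' i, (1 - d i) := by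
      refine le_of_tendsto_of_tendsto (hd.const_sub 1) hp (Eventually.of_forall fun s => ?_)
      simp only
      induction s using Finset.induction_on with
      | empty => simp
      | insert a s ha ih =>
        rw [Finset.sum_insert ha, Finset.prod_insert ha]
        have hn : 0 ≤ ∑ i ∈ s, d i := Finset.sum_nonneg fun i _ => h0 i
        have hP : ∏ i ∈ s, (1 - d i) ≤ 1 := Finset.prod_le_one (fun i _ => by linarith [h1 i]) (fun i _ => by linarith [h0 i])
        nlinarith [h0 a, h1 a]
    linarith
  · have h2 : ∏' i, (1 - d i) ≤ Real.exp (-∑' i, d i) := by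
      refine le_of_tendsto_of_tendsto hp ((Real.continuous_exp.tendsto _).comp hd.neg) (Eventually.of_forall fun s => ?_)
      simp only [Function.comp]
      rw [← Finset.sum_neg_distrib, Real.exp_sum]
      exact Finset.prod_le_prod (fun i _ => by linarith [h1 i]) (fun i _ => Real.one_sub_le_exp_neg _)
    have h3 : Real.exp (-∑' i, d i) ≤ 1 / (1 + ∑' i, d i) := by
      rw [Real.exp_neg, ← one_div]
      apply one_div_le_one_div_of_le (by linarith)
      linarith [Real.add_one_le_exp (∑' i, d i)]
    have h4 : (∑' i, d i) / (1 + ∑' i, d i) = 1 - 1 / (1 + ∑' i, d i) := by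
      field_simp; ring
    rw [h4]; linarith

open Topology in
theorem aux_main : Tendsto (fun Y : ℝ =>
      Y ^ ((4:ℝ)/9) * Real.log Y *
        (1 - ∏' p : Nat.Primes,
          (if Y < ((p : ℕ) : ℝ) then
            (1 + ((p : ℕ) : ℝ) ^ (-(2:ℝ)/3) + ((p : ℕ) : ℝ)⁻¹ +
                ((p : ℕ) : ℝ) ^ (-(4:ℝ)/3)) /
              (1 + ((p : ℕ) : ℝ) ^ (-(2:ℝ)/3) + ((p : ℕ) : ℝ)⁻¹ +
                ((p : ℕ) : ℝ) ^ (-(4:ℝ)/3) + ((p : ℕ) : ℝ) ^ (-(13:ℝ)/9))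
          else 1)))
      atTop (𝓝 (9/4)) := by
  obtain ⟨S, hS⟩ : ∃ S : ℝ → ℝ, S = fun Y => ∑' p : Nat.Primes, (if Y < ((p : ℕ) : ℝ) then ((p : ℕ) : ℝ) ^ (-(13:ℝ)/9) else 0) := ⟨_, rfl⟩
  have hA : Tendsto (fun Y : ℝ => Y ^ ((4:ℝ)/9) * Real.log Y * S Y) atTop (𝓝 (9/4)) := by
    rw [hS]; exact aux_tail_asymp
  have hS0 : Tendsto S atTop (𝓝 0) := by
    have hg : Tendsto (fun Y : ℝ => Y ^ ((4:ℝ)/9) * Real.log Y) atTop atTop :=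
      (tendsto_rpow_atTop (by norm_num)).atTop_mul_atTop₀ Real.tendsto_log_atTop
    have := hA.mul hg.inv_tendsto_atTop
    rw [mul_zero] at this
    refine this.congr' ?_
    filter_upwards [hg.eventually_gt_atTop 0] with Y hY
    simp only [Pi.inv_apply]
    rw [← div_eq_mul_inv, mul_div_cancel_left₀ _ hY.ne']
  have hq : Tendsto (fun Y : ℝ => 1 + 4 * Y ^ (-((2:ℝ)/3))) atTop (𝓝 1) := by
    simpa using ((tendsto_rpow_neg_atTop (show (0:ℝ) < 2/3 by norm_num)).const_mul 4).const_add 1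
  have hlow : Tendsto (fun Y : ℝ => Y ^ ((4:ℝ)/9) * Real.log Y * S Y / ((1 + 4 * Y ^ (-((2:ℝ)/3))) * (1 + S Y))) atTop (𝓝 (9/4)) := by
    have := hA.div (hq.mul (hS0.const_add 1)) (by norm_num)
    rw [show (9/4 : ℝ) / (1 * (1 + 0)) = 9/4 by norm_num] at this
    exact this
  have key : ∀ Y : ℝ, 1 < Y → ∀ P : ℝ, P = (∏' p : Nat.Primes,
          (if Y < ((p : ℕ) : ℝ) then
            (1 + ((p : ℕ) : ℝ) ^ (-(2:ℝ)/3) + ((p : ℕ) : ℝ)⁻¹ +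
                ((p : ℕ) : ℝ) ^ (-(4:ℝ)/3)) /
              (1 + ((p : ℕ) : ℝ) ^ (-(2:ℝ)/3) + ((p : ℕ) : ℝ)⁻¹ +
                ((p : ℕ) : ℝ) ^ (-(4:ℝ)/3) + ((p : ℕ) : ℝ) ^ (-(13:ℝ)/9))
          else 1)) → 1 - P ≤ S Y ∧ S Y / ((1 + 4 * Y ^ (-((2:ℝ)/3))) * (1 + S Y)) ≤ 1 - P := by
    intro Y hY P hP
    obtain ⟨e, he⟩ : ∃ e : Nat.Primes → ℝ, e = fun p : Nat.Primes => (if Y < ((p : ℕ) : ℝ) then ((p : ℕ) : ℝ) ^ (-(13:ℝ)/9) else 0) := ⟨_, rfl⟩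
    obtain ⟨D, hD⟩ : ∃ D : Nat.Primes → ℝ, D = fun p : Nat.Primes => (1 + ((p : ℕ) : ℝ) ^ (-(2:ℝ)/3) + ((p : ℕ) : ℝ)⁻¹ +
                ((p : ℕ) : ℝ) ^ (-(4:ℝ)/3) + ((p : ℕ) : ℝ) ^ (-(13:ℝ)/9)) := ⟨_, rfl⟩
    have hp1 : ∀ p : Nat.Primes, (1:ℝ) < ((p : ℕ) : ℝ) := fun p => by exact_mod_cast p.2.one_lt
    have he0 : ∀ p, 0 ≤ e p := by intro p; rw [he]; dsimp only; split_ifs <;> positivity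
    have hes : Summable e := by
      refine Summable.of_nonneg_of_le he0 ?_ (Nat.Primes.summable_rpow.2 (show -(13:ℝ)/9 < -1 by norm_num))
      intro p; rw [he]; dsimp only; split_ifs
      · exact le_rfl
      · positivity
    have hD1 : ∀ p, 1 ≤ D p := by
      intro p; rw [hD]; dsimp only
      have : 0 < ((p : ℕ) : ℝ) := by linarith [hp1 p]
      have a1 : 0 < ((p : ℕ) : ℝ) ^ (-(2:ℝ)/3) := by positivity
      have a2 : 0 < ((p : ℕ) : ℝ)⁻¹ := by positivity
      have a3 : 0 < ((p : ℕ) : ℝ) ^ (-(4:ℝ)/3) := by positivity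
      have a4 : 0 < ((p : ℕ) : ℝ) ^ (-(13:ℝ)/9) := by positivity
      linarith
    have hDu : ∀ p : Nat.Primes, Y < ((p : ℕ) : ℝ) → D p ≤ 1 + 4 * Y ^ (-((2:ℝ)/3)) := by
      intro p hp; rw [hD]; dsimp only
      have b : ∀ r : ℝ, r ≤ -((2:ℝ)/3) → ((p : ℕ) : ℝ) ^ r ≤ Y ^ (-((2:ℝ)/3)) := by
        intro r hr
        calc ((p : ℕ) : ℝ) ^ r ≤ ((p : ℕ) : ℝ) ^ (-((2:ℝ)/3)) := Real.rpow_le_rpow_of_exponent_le (hp1 p).le hr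
          _ ≤ Y ^ (-((2:ℝ)/3)) := Real.rpow_le_rpow_of_nonpos (by linarith) hp.le (by norm_num)
      have a1 := b (-(2:ℝ)/3) (by norm_num)
      have a2 := b (-1) (by norm_num)
      rw [Real.rpow_neg_one] at a2
      have a3 := b (-(4:ℝ)/3) (by norm_num)
      have a4 := b (-(13:ℝ)/9) (by norm_num)
      linarith
    have hd0 : ∀ p, 0 ≤ e p / D p := fun p => div_nonneg (he0 p) (by linarith [hD1 p])
    have hde : ∀ p, e p / D p ≤ e p := fun p => div_le_self (he0 p) (hD1 p)
    have he1 : ∀ p, e p ≤ 1 := by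
      intro p; rw [he]; dsimp only; split_ifs
      · exact Real.rpow_le_one_of_one_le_of_nonpos (hp1 p).le (by norm_num)
      · norm_num
    have hds : Summable (fun p => e p / D p) := Summable.of_nonneg_of_le hd0 hde hes
    have hb := aux_prod_bounds (fun p => e p / D p) hd0 (fun p => (hde p).trans (he1 p)) hds
    have hPe : P = ∏' p, (1 - e p / D p) := by
      rw [hP]
      refine tprod_congr fun p => ?_
      have := hD1 p
      split_ifs with h
      · rw [eq_sub_iff_add_eq]
        have hep : e p = ((p : ℕ) : ℝ) ^ (-(13:ℝ)/9) := by rw [he]; simp [h]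
        rw [hep]
        have hDp : D p = (1 + ((p : ℕ) : ℝ) ^ (-(2:ℝ)/3) + ((p : ℕ) : ℝ)⁻¹ +
                ((p : ℕ) : ℝ) ^ (-(4:ℝ)/3) + ((p : ℕ) : ℝ) ^ (-(13:ℝ)/9)) := by rw [hD]
        rw [← hDp, ← add_div, ← hDp]
        exact div_self (by linarith)
      · have hep : e p = 0 := by rw [he]; simp [h]
        rw [hep]; simp
    have hSe : S Y = ∑' p, e p := by rw [hS, he]
    have hSd : ∑' p, e p / D p ≤ S Y := by rw [hSe]; exact hds.tsum_le_tsum hde hes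
    have hYp : 0 < Y ^ (-((2:ℝ)/3)) := Real.rpow_pos_of_pos (by linarith) _
    have hSd2 : S Y / (1 + 4 * Y ^ (-((2:ℝ)/3))) ≤ ∑' p, e p / D p := by
      rw [hSe, ← tsum_div_const]
      refine Summable.tsum_le_tsum ?_ (hes.div_const _) hds
      intro p
      by_cases h : Y < ((p : ℕ) : ℝ)
      · exact div_le_div_of_nonneg_left (he0 p) (by linarith [hD1 p]) (hDu p h)
      · have hep : e p = 0 := by rw [he]; simp [h]
        rw [hep]; simp
    have hSn : 0 ≤ S Y := by rw [hSe]; exact tsum_nonneg he0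
    have hdn : 0 ≤ ∑' p, e p / D p := tsum_nonneg hd0
    rw [hPe]
    refine ⟨hb.1.trans hSd, ?_⟩
    refine le_trans ?_ hb.2
    rw [← div_div]
    exact div_le_div₀ hdn hSd2 (by linarith) (by linarith)
  refine tendsto_of_tendsto_of_tendsto_of_le_of_le' hlow hA ?_ ?_
  · filter_upwards [eventually_gt_atTop 1] with Y hY
    have := (key Y hY _ rfl).2
    have hg : 0 ≤ Y ^ ((4:ℝ)/9) * Real.log Y := mul_nonneg (Real.rpow_nonneg (by linarith) _) (Real.log_pos hY).le
    rw [mul_div_assoc]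
    exact mul_le_mul_of_nonneg_left this hg
  · filter_upwards [eventually_gt_atTop 1] with Y hY
    have := (key Y hY _ rfl).1
    have hg : 0 ≤ Y ^ ((4:ℝ)/9) * Real.log Y := mul_nonneg (Real.rpow_nonneg (by linarith) _) (Real.log_pos hY).le
    exact mul_le_mul_of_nonneg_left this hg

theorem tail_product_secondary_term :
    Tendsto (fun X : ℝ =>
      X ^ ((1:ℝ)/9) * Real.log X *
        (1 - ∏' p : Nat.Primes,
          (if X ^ ((1:ℝ)/4) < ((p : ℕ) : ℝ) then
            (1 + ((p : ℕ) : ℝ) ^ (-(2:ℝ)/3) + ((p : ℕ) : ℝ)⁻¹ +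
                ((p : ℕ) : ℝ) ^ (-(4:ℝ)/3)) /
              (1 + ((p : ℕ) : ℝ) ^ (-(2:ℝ)/3) + ((p : ℕ) : ℝ)⁻¹ +
                ((p : ℕ) : ℝ) ^ (-(4:ℝ)/3) + ((p : ℕ) : ℝ) ^ (-(13:ℝ)/9))
          else 1)))
      atTop (nhds 9) := by
  have h := (aux_main.comp (tendsto_rpow_atTop (show (0:ℝ) < 1/4 by norm_num))).const_mul 4
  rw [show (4:ℝ) * (9/4) = 9 by norm_num] at h
  refine h.congr' ?_
  filter_upwards [eventually_gt_atTop 1] with X hX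
  simp only [Function.comp]
  rw [← Real.rpow_mul (by linarith), Real.log_rpow (by linarith), show (1:ℝ)/4 * (4/9) = 1/9 by norm_num]
  ring
end
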